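/- Let n ≥ 1, α ∈ (0,1), and λ, Λ > 0. There is a constant C = C(n, λ, Λ, α) with the following property. Let B₂ ⊂ ℝ^n be the ball of radius 2 centered at the origin and B₁ the concentric ball of radius 1. Suppose a_{ij}, b_i, c, f, u : B₂ × [−2, 0] → ℝ are such that u is continuous together with its first and second spatial derivatives and its first time derivative, and u is a classical solution of ∂u/∂t − a_{ij} D²_{ij}u − b_i D_i u − c u = f on B₂ × [−2, 0]. Assume the coefficients have spatial Hölder norms bounded uniformly in time, sup_{t∈[−2,0]} ( ‖a_{ij}(·,t)‖_{C^{0,α}(B₂)} + ‖b_i(·,t)‖_{C^{0,α}(B₂)} + ‖c(·,t)‖_{C^{0,α}(B₂)} ) < Λ (summed over all indices i, j), and that the equation is uniformly parabolic: a_{ij}(x,t) ξ_i ξ_j ≥ λ|ξ|² for all (x,t) ∈ B₂ × [−2,0] and all ξ ∈ ℝ^n. Then for every T ∈ (−1, 0], sup_{t∈[−1,T]} ‖u(·,t)‖_{C^{2,α}(B₁)} ≤ C sup_{t∈[−2,T]} ( ‖u(·,t)‖_{C⁰(B₂)} + ‖f(·,t)‖_{C^{0,α}(B₂)} ). -/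

import Mathlib

open Metric Set

/-- `HolderNormLE n α g M` says that the `C^{0,α}` norm of `g` on the ball `B₂ ⊆ ℝⁿ`,
i.e. `sup_{B₂} |g| + [g]_{α;B₂}`, is at most `M`. -/
def HolderNormLE (n : ℕ) (α : ℝ) (g : EuclideanSpace ℝ (Fin n) → ℝ) (M : ℝ) : Prop :=
  ∃ S H : ℝ, 0 ≤ S ∧ 0 ≤ H ∧ S + H ≤ M ∧
    (∀ x ∈ ball (0 : EuclideanSpace ℝ (Fin n)) 2, |g x| ≤ S) ∧
    (∀ x ∈ ball (0 : EuclideanSpace ℝ (Fin n)) 2,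
      ∀ y ∈ ball (0 : EuclideanSpace ℝ (Fin n)) 2, |g x - g y| ≤ H * ‖x - y‖ ^ α)



abbrev EE (n : ℕ) := EuclideanSpace ℝ (Fin n)

/-- contraction of a coefficient matrix with a bilinear form -/
noncomputable def con {n : ℕ} (A : Fin n → Fin n → ℝ) (B : EE n →L[ℝ] EE n →L[ℝ] ℝ) : ℝ :=
  ∑ i : Fin n, ∑ j : Fin n, A i j *
    B (EuclideanSpace.single i (1 : ℝ)) (EuclideanSpace.single j (1 : ℝ))

lemma con_sub_left {n : ℕ} (A A' : Fin n → Fin n → ℝ) (B : EE n →L[ℝ] EE n →L[ℝ] ℝ) :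
    con (fun i j => A i j - A' i j) B = con A B - con A' B := by
  simp only [con, sub_mul, Finset.sum_sub_distrib]

lemma con_add_right {n : ℕ} (A : Fin n → Fin n → ℝ) (B B' : EE n →L[ℝ] EE n →L[ℝ] ℝ) :
    con A (B + B') = con A B + con A B' := by
  simp only [con, _root_.add_apply, mul_add, Finset.sum_add_distrib]

lemma con_sub_right {n : ℕ} (A : Fin n → Fin n → ℝ) (B B' : EE n →L[ℝ] EE n →L[ℝ] ℝ) :
    con A (B - B') = con A B - con A B' := by
  simp only [con, _root_.sub_apply, mul_sub, Finset.sum_sub_distrib]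

lemma con_smul_right {n : ℕ} (A : Fin n → Fin n → ℝ) (c : ℝ) (B : EE n →L[ℝ] EE n →L[ℝ] ℝ) :
    con A (c • B) = c * con A B := by
  simp only [con, _root_.smul_apply, smul_eq_mul, Finset.mul_sum]
  refine Finset.sum_congr rfl fun i _ => Finset.sum_congr rfl fun j _ => by ring

lemma abs_con_le {n : ℕ} (A : Fin n → Fin n → ℝ) (B : EE n →L[ℝ] EE n →L[ℝ] ℝ) :
    |con A B| ≤ (∑ i, ∑ j, |A i j|) * ‖B‖ := by
  unfold con
  refine (Finset.abs_sum_le_sum_abs _ _).trans ?_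
  rw [Finset.sum_mul]
  refine Finset.sum_le_sum fun i _ => ?_
  refine (Finset.abs_sum_le_sum_abs _ _).trans ?_
  rw [Finset.sum_mul]
  refine Finset.sum_le_sum fun j _ => ?_
  rw [abs_mul]
  refine mul_le_mul_of_nonneg_left ?_ (abs_nonneg _)
  have := B.le_opNorm₂ (EuclideanSpace.single i (1 : ℝ)) (EuclideanSpace.single j (1 : ℝ))
  simpa using this

lemma vec_expand {n : ℕ} (v : EE n) :
    v = ∑ i, v i • EuclideanSpace.single i (1 : ℝ) := by
  ext j
  simp [Finset.sum_apply, Pi.single_apply]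

lemma bilin_expand {n : ℕ} (B : EE n →L[ℝ] EE n →L[ℝ] ℝ) (v w : EE n) :
    B v w = ∑ i, ∑ j, v i * w j *
      B (EuclideanSpace.single i (1 : ℝ)) (EuclideanSpace.single j (1 : ℝ)) := by
  conv_lhs => rw [vec_expand v, vec_expand w]
  simp only [map_sum, map_smul, _root_.sum_apply, _root_.smul_apply,
    smul_eq_mul, Finset.mul_sum]
  rw [Finset.sum_comm]
  refine Finset.sum_congr rfl fun i _ => Finset.sum_congr rfl fun j _ => by ring

open scoped MatrixOrder in
lemma psd_decomp {n : ℕ} (A : Fin n → Fin n → ℝ) (lam : ℝ) (hlam : 0 < lam)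
    (hell : ∀ ξ : Fin n → ℝ, lam * (∑ i, ξ i ^ 2) ≤ ∑ i, ∑ j, A i j * ξ i * ξ j)
    (e : EE n) (he : ‖e‖ = 1) :
    ∃ ξ : Fin n → EE n, ∀ B : EE n →L[ℝ] EE n →L[ℝ] ℝ, (∀ v w, B v w = B w v) →
      con A B = ∑ k, B (ξ k) (ξ k) + lam * B e e := by
  let S : Matrix (Fin n) (Fin n) ℝ := fun i j => (A i j + A j i) / 2 - lam * (e i * e j)
  have hS : S.PosSemidef := by
    refine Matrix.PosSemidef.of_dotProduct_mulVec_nonneg ?_ ?_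
    · ext i j
      rw [Matrix.conjTranspose_apply, star_trivial]
      simp only [S]
      ring
    · intro x
      have h1 := hell x
      have h2 : (∑ i, x i * e i) ^ 2 ≤ ∑ i, x i ^ 2 := by
        have := Finset.sum_mul_sq_le_sq_mul_sq Finset.univ x (fun i => e i)
        have h3 : ∑ i, e i ^ 2 = 1 := by
          have := EuclideanSpace.norm_sq_eq e
          rw [he] at this
          simpa using this.symm
        rw [h3, mul_one] at this
        exact this
      have h4 : star x ⬝ᵥ S.mulVec x = ∑ i, ∑ j, A i j * x i * x j - lam * (∑ i, x i * e i) ^ 2 := by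
        have h5 : ∑ i, ∑ j, A j i * x i * x j = ∑ i, ∑ j, A i j * x i * x j := by
          rw [Finset.sum_comm]
          refine Finset.sum_congr rfl fun i _ => Finset.sum_congr rfl fun j _ => by ring
        have h6 : star x ⬝ᵥ S.mulVec x = (∑ i, ∑ j, A i j * x i * x j) / 2
            + (∑ i, ∑ j, A j i * x i * x j) / 2 - lam * (∑ i, x i * e i) ^ 2 := by
          rw [pow_two, Finset.sum_mul_sum, Finset.mul_sum, Finset.sum_div, Finset.sum_div,
            ← Finset.sum_add_distrib, ← Finset.sum_sub_distrib]
          simp only [dotProduct, Matrix.mulVec, S, Pi.star_apply, star_trivial, Finset.mul_sum]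
          refine Finset.sum_congr rfl fun i _ => ?_
          rw [Finset.sum_div, Finset.sum_div,
            ← Finset.sum_add_distrib, ← Finset.sum_sub_distrib]
          refine Finset.sum_congr rfl fun j _ => by ring
        rw [h6, h5]; ring
      rw [h4]
      nlinarith
  obtain ⟨R, hR⟩ := CStarAlgebra.nonneg_iff_eq_star_mul_self.mp hS.nonneg
  refine ⟨fun k => WithLp.toLp 2 (R k), fun B hB => ?_⟩
  have hRij : ∀ i j, (A i j + A j i) / 2 = ∑ k, R k i * R k j + lam * (e i * e j) := by
    intro i j
    have := congrFun (congrFun hR i) j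
    simp only [S, Matrix.mul_apply, Matrix.star_apply, star_trivial] at this
    linarith
  have h7 : con A B = ∑ i, ∑ j, (A i j + A j i) / 2 *
      B (EuclideanSpace.single i (1 : ℝ)) (EuclideanSpace.single j (1 : ℝ)) := by
    have h8 : con A B = ∑ i, ∑ j, A j i *
      B (EuclideanSpace.single i (1 : ℝ)) (EuclideanSpace.single j (1 : ℝ)) := by
      unfold con
      rw [Finset.sum_comm]
      refine Finset.sum_congr rfl fun i _ => Finset.sum_congr rfl fun j _ => by rw [hB]
    have h9 : con A B = (con A B + con A B) / 2 := by ring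
    rw [h9]
    nth_rewrite 2 [h8]
    unfold con
    rw [← Finset.sum_add_distrib, Finset.sum_div]
    refine Finset.sum_congr rfl fun i _ => ?_
    rw [← Finset.sum_add_distrib, Finset.sum_div]
    refine Finset.sum_congr rfl fun j _ => by ring
  rw [h7, bilin_expand B e e]
  have h10 : ∑ k, B (WithLp.toLp 2 (R k)) (WithLp.toLp 2 (R k)) = ∑ i, ∑ j, (∑ k, R k i * R k j) *
      B (EuclideanSpace.single i (1 : ℝ)) (EuclideanSpace.single j (1 : ℝ)) := by
    simp_rw [bilin_expand B (WithLp.toLp 2 (R _))]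
    rw [Finset.sum_comm]
    refine Finset.sum_congr rfl fun i _ => ?_
    rw [Finset.sum_comm]
    refine Finset.sum_congr rfl fun j _ => ?_
    rw [Finset.sum_mul]
  rw [h10, Finset.mul_sum, ← Finset.sum_add_distrib]
  refine Finset.sum_congr rfl fun i _ => ?_
  rw [Finset.mul_sum, ← Finset.sum_add_distrib]
  refine Finset.sum_congr rfl fun j _ => ?_
  rw [hRij]; ring

/-- iteration to the fixed point of a contraction of constants -/
lemma contraction_const {ι : Type*} (f g : ι → ℝ) (θ c : ℝ) (hθ0 : 0 ≤ θ) (hθ : θ < 1) (hc : 0 ≤ c)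
    (hstep : ∀ B : ℝ, 0 < B → (∀ i, f i ≤ B * g i) → ∀ i, f i ≤ (θ * B + c) * g i)
    (h0 : ∃ B : ℝ, 0 < B ∧ ∀ i, f i ≤ B * g i) (hg : ∀ i, 0 ≤ g i) :
    ∀ i, f i ≤ (c / (1 - θ)) * g i := by
  obtain ⟨B, hB, hB2⟩ := h0
  have h1 : 0 < 1 - θ := by linarith
  set L := c / (1 - θ) with hL
  have hL0 : 0 ≤ L := by positivity
  have hLe : θ * L + c = L := by
    rw [hL]; field_simp; ring
  have key : ∀ δ : ℝ, 0 < δ → ∀ m : ℕ, ∀ i, f i ≤ (θ ^ m * B + L + δ) * g i := by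
    intro δ hδ m
    induction m with
    | zero =>
      intro i
      refine (hB2 i).trans (mul_le_mul_of_nonneg_right ?_ (hg i))
      simp; linarith
    | succ m ih =>
      intro i
      have := hstep (θ ^ m * B + L + δ) (by positivity) ih i
      refine this.trans (mul_le_mul_of_nonneg_right ?_ (hg i))
      rw [pow_succ]
      nlinarith
  intro i
  have h2 : ∀ δ : ℝ, 0 < δ → f i ≤ (L + δ) * g i := by
    intro δ hδ
    have ht : Filter.Tendsto (fun m : ℕ => (θ ^ m * B + L + δ) * g i) Filter.atTop
        (nhds ((0 * B + L + δ) * g i)) :=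
      ((((tendsto_pow_atTop_nhds_zero_of_lt_one hθ0 hθ).mul_const B).add_const L).add_const
        δ).mul_const _
    have := ge_of_tendsto' ht (fun m => key δ hδ m i)
    simpa using this
  have ht : Filter.Tendsto (fun δ : ℝ => (L + δ) * g i) (nhdsWithin 0 (Ioi 0))
      (nhds ((L + 0) * g i)) := by
    refine Filter.Tendsto.mono_left ?_ nhdsWithin_le_nhds
    exact (Continuous.tendsto (by fun_prop) 0)
  have := ge_of_tendsto ht (by filter_upwards [self_mem_nhdsWithin] with δ hδ using h2 δ hδ)
  simpa using this

/-- second derivative test -/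
lemma second_deriv_nonpos (f f' : ℝ → ℝ) (c : ℝ)
    (h1 : ∀ᶠ s in nhds (0 : ℝ), HasDerivAt f (f' s) s) (h2 : HasDerivAt f' c 0)
    (hmax : IsLocalMax f 0) : c ≤ 0 := by
  by_contra hc
  push Not at hc
  have he : deriv f =ᶠ[nhds 0] f' := h1.mono fun s hs => hs.deriv
  have hd : deriv (deriv f) 0 = c := by
    rw [he.deriv_eq]; exact h2.deriv
  have hf0 : deriv f 0 = 0 := hmax.deriv_eq_zero
  have hmin : IsLocalMin f 0 := by
    apply isLocalMin_of_deriv_deriv_pos (by rw [hd]; exact hc) hf0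
    exact h1.self_of_nhds.continuousAt
  have hconst : f =ᶠ[nhds 0] fun _ => f 0 := by
    filter_upwards [hmin, hmax] with s a b using le_antisymm b a
  have h3 : deriv f =ᶠ[nhds 0] fun _ => 0 := by
    have := hconst.deriv
    simpa using this
  have : deriv (deriv f) 0 = 0 := by
    rw [h3.deriv_eq]; simp
  linarith

/-- crude second order Taylor bound on `[0,1]` -/
lemma taylor_crude (φ φ' φ'' : ℝ → ℝ) (M : ℝ) (h1 : ∀ s ∈ Icc (0 : ℝ) 1, HasDerivAt φ (φ' s) s)
    (h2 : ∀ s ∈ Icc (0 : ℝ) 1, HasDerivAt φ' (φ'' s) s) (hM : ∀ s ∈ Icc (0 : ℝ) 1, |φ'' s| ≤ M)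
    (h0 : φ 0 = 0) (h0' : φ' 0 = 0) : |φ 1| ≤ M := by
  have hM0 : 0 ≤ M := (abs_nonneg _).trans (hM 0 (by simp))
  have a1 : ∀ s ∈ Icc (0 : ℝ) 1, |φ' s| ≤ M := by
    intro s hs
    have := (convex_Icc (0 : ℝ) 1).norm_image_sub_le_of_norm_hasDerivWithin_le
      (fun x hx => (h2 x hx).hasDerivWithinAt) (fun x hx => hM x hx) (x := 0) (y := s) (by simp) hs
    rw [h0', sub_zero, sub_zero] at this
    refine this.trans ?_
    have : ‖s‖ ≤ 1 := by rw [Real.norm_eq_abs, abs_of_nonneg hs.1]; exact hs.2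
    nlinarith
  have := (convex_Icc (0 : ℝ) 1).norm_image_sub_le_of_norm_hasDerivWithin_le
      (fun x hx => (h1 x hx).hasDerivWithinAt) (fun x hx => a1 x hx) (x := 0) (y := 1)
        (by simp) (by simp)
  simpa [h0] using this

/-- regularity package -/
structure Reg {n : ℕ} (s : Set (EE n)) (I : Set ℝ) (u : EE n → ℝ → ℝ)
    (u1 : EE n → ℝ → EE n →L[ℝ] ℝ) (u2 : EE n → ℝ → EE n →L[ℝ] EE n →L[ℝ] ℝ)
    (ut : EE n → ℝ → ℝ) : Prop where
  d1 : ∀ x ∈ s, ∀ t ∈ I, HasFDerivAt (fun y => u y t) (u1 x t) x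
  d2 : ∀ x ∈ s, ∀ t ∈ I, HasFDerivAt (fun y => u1 y t) (u2 x t) x
  dt : ∀ x ∈ s, ∀ t ∈ I, HasDerivWithinAt (u x) (ut x t) I t
  cont : ContinuousOn (fun p : EE n × ℝ => u p.1 p.2) (s ×ˢ I)

lemma Reg.mono {n : ℕ} {s s' : Set (EE n)} {I I' : Set ℝ} {u u1 u2 ut}
    (h : Reg s I u u1 u2 ut) (hs : s' ⊆ s) (hI : I' ⊆ I) : Reg (n := n) s' I' u u1 u2 ut :=
  ⟨fun x hx t ht => h.d1 x (hs hx) t (hI ht), fun x hx t ht => h.d2 x (hs hx) t (hI ht),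
    fun x hx t ht => (h.dt x (hs hx) t (hI ht)).mono hI, h.cont.mono (prod_mono hs hI)⟩

lemma Reg.symm {n : ℕ} {s : Set (EE n)} {I : Set ℝ} {u u1 u2 ut}
    (h : Reg (n := n) s I u u1 u2 ut) (hs : IsOpen s) {x t} (hx : x ∈ s) (ht : t ∈ I) (v w : EE n) :
    u2 x t v w = u2 x t w v := by
  refine second_derivative_symmetric_of_eventually (𝕜 := ℝ) (f := fun y => u y t)
    (f' := fun y => u1 y t) (x := x) ?_ (h.d2 x hx t ht) v w
  filter_upwards [hs.mem_nhds hx] with y hy using h.d1 y hy t ht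

/-- second difference -/
def dd {n : ℕ} {F : Type*} [AddCommGroup F] [Module ℝ F] (k : EE n) (u : EE n → ℝ → F) :
    EE n → ℝ → F :=
  fun y t => u (y + k) t + u (y - k) t - (2 : ℝ) • u y t

lemma Reg.dd {n : ℕ} {s s' : Set (EE n)} {I : Set ℝ} {u u1 u2 ut}
    (h : Reg (n := n) s I u u1 u2 ut) (k : EE n) (h0 : ∀ y ∈ s', y ∈ s)
    (hp : ∀ y ∈ s', y + k ∈ s) (hm : ∀ y ∈ s', y - k ∈ s) :
    Reg (n := n) s' I (dd k u) (dd k u1) (dd k u2) (dd k ut) := by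
  refine ⟨fun x hx t ht => ?_, fun x hx t ht => ?_, fun x hx t ht => ?_, ?_⟩
  · have a := (hasFDerivAt_comp_add_right k).mpr (h.d1 _ (hp x hx) t ht)
    have b := (hasFDerivAt_comp_sub k).mpr (h.d1 _ (hm x hx) t ht)
    exact (a.add b).sub ((h.d1 _ (h0 x hx) t ht).const_smul (2 : ℝ))
  · have a := (hasFDerivAt_comp_add_right k).mpr (h.d2 _ (hp x hx) t ht)
    have b := (hasFDerivAt_comp_sub k).mpr (h.d2 _ (hm x hx) t ht)
    exact (a.add b).sub ((h.d2 _ (h0 x hx) t ht).const_smul (2 : ℝ))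
  · exact ((h.dt _ (hp x hx) t ht).add (h.dt _ (hm x hx) t ht)).sub
      ((h.dt _ (h0 x hx) t ht).const_smul (2 : ℝ))
  · have a : ContinuousOn (fun p : EE n × ℝ => u (p.1 + k) p.2) (s' ×ˢ I) :=
      h.cont.comp (f := fun p : EE n × ℝ => (p.1 + k, p.2)) (by fun_prop)
        (fun p hx => ⟨hp _ hx.1, hx.2⟩)
    have b : ContinuousOn (fun p : EE n × ℝ => u (p.1 - k) p.2) (s' ×ˢ I) :=
      h.cont.comp (f := fun p : EE n × ℝ => (p.1 - k, p.2)) (by fun_prop)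
        (fun p hx => ⟨hm _ hx.1, hx.2⟩)
    have c : ContinuousOn (fun p : EE n × ℝ => u p.1 p.2) (s' ×ˢ I) :=
      h.cont.mono (prod_mono h0 subset_rfl)
    exact (a.add b).sub (c.const_smul (2 : ℝ))


lemma Reg.line1 {n : ℕ} {s : Set (EE n)} {I : Set ℝ} {u u1 u2 ut}
    (h : Reg (n := n) s I u u1 u2 ut) {y ξ : EE n} {t σ : ℝ} (hy : y + σ • ξ ∈ s) (ht : t ∈ I) :
    HasDerivAt (fun σ : ℝ => u (y + σ • ξ) t) (u1 (y + σ • ξ) t ξ) σ := by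
  have hl : HasDerivAt (fun σ : ℝ => y + σ • ξ) ξ σ := by
    simpa using ((hasDerivAt_id σ).smul_const ξ).const_add y
  exact (h.d1 _ hy t ht).comp_hasDerivAt σ hl

lemma Reg.line2 {n : ℕ} {s : Set (EE n)} {I : Set ℝ} {u u1 u2 ut}
    (h : Reg (n := n) s I u u1 u2 ut) {y ξ : EE n} {t σ : ℝ} (hy : y + σ • ξ ∈ s) (ht : t ∈ I) :
    HasDerivAt (fun σ : ℝ => u1 (y + σ • ξ) t ξ) (u2 (y + σ • ξ) t ξ ξ) σ := by
  have hl : HasDerivAt (fun σ : ℝ => y + σ • ξ) ξ σ := by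
    simpa using ((hasDerivAt_id σ).smul_const ξ).const_add y
  have h2 := (h.d2 _ hy t ht).comp_hasDerivAt σ hl
  exact (ContinuousLinearMap.apply ℝ ℝ ξ).hasFDerivAt.comp_hasDerivAt σ h2

lemma left_deriv_nonneg {g : ℝ → ℝ} {a b s c : ℝ} (hs : a < s) (hsb : s ≤ b)
    (hmax : ∀ s' ∈ Icc a b, g s' ≤ g s) (hd : HasDerivWithinAt g c (Icc a b) s) : 0 ≤ c := by
  have h1 : IsLocalMaxOn g (Icc a b) s := by
    filter_upwards [self_mem_nhdsWithin] with s' hs' using hmax s' hs'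
  have h2 : a - s ∈ posTangentConeAt (Icc a b) s := by
    apply sub_mem_posTangentConeAt_of_segment_subset
    exact (convex_Icc a b).segment_subset ⟨hs.le, hsb⟩ ⟨le_rfl, hs.le.trans hsb⟩
  have h3 := h1.hasFDerivWithinAt_nonpos hd.hasFDerivWithinAt h2
  simp at h3
  nlinarith

set_option maxHeartbeats 1000000 in
lemma grad_est {n : ℕ} {lam Λ r Γ W μ : ℝ} (hlam : 0 < lam) (hr : 0 < r) (hW : 0 ≤ W)
    {p : EE n} {t0 : ℝ} {s : Set (EE n)} (hso : IsOpen s) (hs : closedBall p (2 * r) ⊆ s)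
    {A : ℝ → Fin n → Fin n → ℝ}
    (hell : ∀ t ∈ Icc (t0 - r ^ 2) t0, ∀ ξ : Fin n → ℝ,
      lam * (∑ i, ξ i ^ 2) ≤ ∑ i, ∑ j, A t i j * ξ i * ξ j)
    (hA : ∀ t ∈ Icc (t0 - r ^ 2) t0, ∑ i, ∑ j, |A t i j| ≤ Λ)
    {w w1 w2 wt} (hreg : Reg s (Icc (t0 - r ^ 2) t0) w w1 w2 wt)
    (hosc : ∀ t ∈ Icc (t0 - r ^ 2) t0, ∀ y ∈ closedBall p (2 * r), ∀ y' ∈ closedBall p (2 * r),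
      w y t - w y' t ≤ W)
    (heq : ∀ t ∈ Icc (t0 - r ^ 2) t0, ∀ y ∈ closedBall p (2 * r),
      |wt y t - con (A t) (w2 y t)| ≤ Γ)
    (hμ1 : W ≤ μ * r ^ 2) (hμ2 : 2 * Γ + W / r ^ 2 * (1 + 2 * Λ) < 2 * lam * μ)
    {e : EE n} (he : ‖e‖ = 1) {h : ℝ} (hh : h ∈ Icc 0 r) :
    w (p + h • e) t0 - w (p - h • e) t0 ≤ 2 * r * μ * h := by
  have hr2 : 0 < r ^ 2 := by positivity
  have hμ : 0 ≤ μ := by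
    by_contra hc
    push Not at hc
    nlinarith
  have hWr : 0 ≤ W / r ^ 2 := by positivity
  set ω := W / r ^ 2 with hω
  have hωr : ω * r ^ 2 = W := by rw [hω]; field_simp
  set I := Icc (t0 - r ^ 2) t0 with hI
  let Ψ : EE n × ℝ × ℝ → ℝ := fun q => w (q.1 + q.2.1 • e) q.2.2 - w (q.1 - q.2.1 • e) q.2.2
    - (ω * (‖q.1 - p‖ ^ 2 + (t0 - q.2.2)) + μ * (q.2.1 * (2 * r - q.2.1)))
  let K : Set (EE n × ℝ × ℝ) := closedBall p r ×ˢ (Icc 0 r ×ˢ I)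
  have hK : IsCompact K := (isCompact_closedBall p r).prod (isCompact_Icc.prod isCompact_Icc)
  have hmemp : ∀ x ∈ closedBall p r, ∀ h ∈ Icc 0 r, x + h • e ∈ closedBall p (2 * r) := by
    intro x hx h hh
    rw [mem_closedBall, dist_eq_norm] at hx ⊢
    calc ‖x + h • e - p‖ = ‖(x - p) + h • e‖ := by congr 1; abel
      _ ≤ ‖x - p‖ + ‖h • e‖ := norm_add_le _ _
      _ ≤ r + r := by
        refine add_le_add hx ?_
        rw [norm_smul, he, mul_one, Real.norm_eq_abs, abs_of_nonneg hh.1]; exact hh.2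
      _ = 2 * r := by ring
  have hmemm : ∀ x ∈ closedBall p r, ∀ h ∈ Icc 0 r, x - h • e ∈ closedBall p (2 * r) := by
    intro x hx h hh
    rw [mem_closedBall, dist_eq_norm] at hx ⊢
    calc ‖x - h • e - p‖ = ‖(x - p) - h • e‖ := by congr 1; abel
      _ ≤ ‖x - p‖ + ‖h • e‖ := norm_sub_le _ _
      _ ≤ r + r := by
        refine add_le_add hx ?_
        rw [norm_smul, he, mul_one, Real.norm_eq_abs, abs_of_nonneg hh.1]; exact hh.2
      _ = 2 * r := by ring
  have hΨc : ContinuousOn Ψ K := by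
    have c1 : ContinuousOn (fun q : EE n × ℝ × ℝ => w (q.1 + q.2.1 • e) q.2.2) K :=
      hreg.cont.comp (f := fun q : EE n × ℝ × ℝ => (q.1 + q.2.1 • e, q.2.2)) (by fun_prop)
        (fun q hq => ⟨hs (hmemp _ hq.1 _ hq.2.1), hq.2.2⟩)
    have c2 : ContinuousOn (fun q : EE n × ℝ × ℝ => w (q.1 - q.2.1 • e) q.2.2) K :=
      hreg.cont.comp (f := fun q : EE n × ℝ × ℝ => (q.1 - q.2.1 • e, q.2.2)) (by fun_prop)
        (fun q hq => ⟨hs (hmemm _ hq.1 _ hq.2.1), hq.2.2⟩)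
    exact (c1.sub c2).sub (by fun_prop)
  have ht0 : t0 ∈ I := ⟨by linarith, le_rfl⟩
  have hKn : (p, h, t0) ∈ K := ⟨by simp [hr.le], hh, ht0⟩
  obtain ⟨⟨x, η, τ⟩, hqK, hqmax⟩ := hK.exists_isMaxOn ⟨_, hKn⟩ hΨc
  have hmaxval : Ψ (x, η, τ) ≤ 0 := by
    by_contra hpos
    push Not at hpos
    obtain ⟨hx, hη, hτ⟩ := hqK
    simp only at hx hη hτ
    have hval : ω * (‖x - p‖ ^ 2 + (t0 - τ)) + μ * (η * (2 * r - η))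
        < w (x + η • e) τ - w (x - η • e) τ := by
      simp only [Ψ] at hpos; linarith
    have hψ : w (x + η • e) τ - w (x - η • e) τ ≤ W :=
      hosc τ hτ _ (hmemp x hx η hη) _ (hmemm x hx η hη)
    have hxp : ‖x - p‖ ≤ r := by rw [mem_closedBall, dist_eq_norm] at hx; exact hx
    have b1 : 0 ≤ ω * ‖x - p‖ ^ 2 := by positivity
    have b2 : 0 ≤ ω * (t0 - τ) := mul_nonneg hWr (by linarith [hτ.2])
    have b3 : 0 ≤ μ * (η * (2 * r - η)) :=
      mul_nonneg hμ (mul_nonneg hη.1 (by linarith [hη.2]))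
    have hx' : ‖x - p‖ < r := by
      refine lt_of_le_of_ne hxp fun hc => ?_
      rw [hc] at hval
      nlinarith
    have hτ' : t0 - r ^ 2 < τ := by
      refine lt_of_le_of_ne hτ.1 fun hc => ?_
      rw [← hc] at hval hψ
      nlinarith
    have hη0 : 0 < η := by
      refine lt_of_le_of_ne hη.1 fun hc => ?_
      rw [← hc] at hval
      simp at hval
      nlinarith
    have hη1 : η < r := by
      refine lt_of_le_of_ne hη.2 fun hc => ?_
      rw [hc] at hval hψ
      nlinarith
    have hps := hs (hmemp x hx η hη)
    have hms := hs (hmemm x hx η hη)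
    -- spatial directions
    have hnear : ∀ y ∈ s, ∀ ξ : EE n, ∀ᶠ σ : ℝ in nhds 0, y + σ • ξ ∈ s := by
      intro y hy ξ
      have : Filter.Tendsto (fun σ : ℝ => y + σ • ξ) (nhds 0) (nhds (y + (0 : ℝ) • ξ)) :=
        Continuous.tendsto (by fun_prop) 0
      rw [zero_smul, add_zero] at this
      exact this (hso.mem_nhds hy)
    have dirx : ∀ ξ : EE n, w2 (x + η • e) τ ξ ξ - w2 (x - η • e) τ ξ ξ ≤ 2 * ω * ‖ξ‖ ^ 2 := by
      intro ξ
      have key := second_deriv_nonpos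
        (fun σ => w ((x + η • e) + σ • ξ) τ - w ((x - η • e) + σ • ξ) τ
          - (ω * ((‖x - p‖ ^ 2 + 2 * σ * inner ℝ (x - p) ξ + σ ^ 2 * ‖ξ‖ ^ 2) + (t0 - τ))
              + μ * (η * (2 * r - η))))
        (fun σ => w1 ((x + η • e) + σ • ξ) τ ξ - w1 ((x - η • e) + σ • ξ) τ ξ
          - ω * (2 * inner ℝ (x - p) ξ + 2 * σ * ‖ξ‖ ^ 2))
        (w2 ((x + η • e) + (0 : ℝ) • ξ) τ ξ ξ - w2 ((x - η • e) + (0 : ℝ) • ξ) τ ξ ξ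
          - ω * (2 * ‖ξ‖ ^ 2)) ?_ ?_ ?_
      · simp only [zero_smul, add_zero] at key
        linarith
      · filter_upwards [hnear _ hps ξ, hnear _ hms ξ] with σ h1 h2
        refine ((hreg.line1 h1 hτ).sub (hreg.line1 h2 hτ)).sub ?_
        have : HasDerivAt (fun σ : ℝ => (‖x - p‖ ^ 2 + 2 * σ * inner ℝ (x - p) ξ + σ ^ 2 * ‖ξ‖ ^ 2)
            + (t0 - τ)) (2 * inner ℝ (x - p) ξ + 2 * σ * ‖ξ‖ ^ 2) σ := by
          have a1 := ((hasDerivAt_id σ).const_mul 2).mul_const (inner ℝ (x - p) ξ)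
          have a2 := (hasDerivAt_pow 2 σ).mul_const (‖ξ‖ ^ 2)
          have := ((a1.const_add (‖x - p‖ ^ 2)).add a2).add_const (t0 - τ)
          refine this.congr_deriv ?_
          norm_num
        exact (this.const_mul ω).add_const _
      · refine ((hreg.line2 (by simpa using hps) hτ).sub
          (hreg.line2 (by simpa using hms) hτ)).sub ?_
        have : HasDerivAt (fun σ : ℝ => 2 * inner ℝ (x - p) ξ + 2 * σ * ‖ξ‖ ^ 2)
            (2 * ‖ξ‖ ^ 2) 0 := by
          have := (((hasDerivAt_id (0 : ℝ)).const_mul 2).mul_const (‖ξ‖ ^ 2)).const_add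
            (2 * inner ℝ (x - p) ξ)
          simpa using this
        exact this.const_mul ω
      · have hn : ∀ᶠ σ : ℝ in nhds 0, x + σ • ξ ∈ ball p r := by
          have : Filter.Tendsto (fun σ : ℝ => x + σ • ξ) (nhds 0) (nhds (x + (0 : ℝ) • ξ)) :=
            Continuous.tendsto (by fun_prop) 0
          rw [zero_smul, add_zero] at this
          exact this (isOpen_ball.mem_nhds (by rw [mem_ball, dist_eq_norm]; exact hx'))
        filter_upwards [hn] with σ hσ
        have hm : Ψ (x + σ • ξ, η, τ) ≤ Ψ (x, η, τ) :=
          hqmax ⟨ball_subset_closedBall hσ, hη, hτ⟩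
        simp only [Ψ] at hm
        have e1 : ‖x + σ • ξ - p‖ ^ 2
            = ‖x - p‖ ^ 2 + 2 * σ * inner ℝ (x - p) ξ + σ ^ 2 * ‖ξ‖ ^ 2 := by
          rw [show x + σ • ξ - p = (x - p) + σ • ξ by abel, norm_add_sq_real, inner_smul_right,
            norm_smul, mul_pow, Real.norm_eq_abs, sq_abs]
          ring
        rw [e1, show x + σ • ξ + η • e = x + η • e + σ • ξ by abel,
          show x + σ • ξ - η • e = x - η • e + σ • ξ by abel] at hm
        simp only [zero_smul, add_zero, mul_zero, zero_mul]
        norm_num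
        linarith
    have dirh : w2 (x + η • e) τ e e - w2 (x - η • e) τ e e ≤ - (2 * μ) := by
      have key := second_deriv_nonpos
        (fun σ => w ((x + η • e) + σ • e) τ - w ((x - η • e) + σ • (-e)) τ
          - (ω * (‖x - p‖ ^ 2 + (t0 - τ)) + μ * ((η + σ) * (2 * r - (η + σ)))))
        (fun σ => w1 ((x + η • e) + σ • e) τ e - w1 ((x - η • e) + σ • (-e)) τ (-e)
          - μ * (2 * r - 2 * (η + σ)))
        (w2 ((x + η • e) + (0 : ℝ) • e) τ e e - w2 ((x - η • e) + (0 : ℝ) • (-e)) τ (-e) (-e)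
          - μ * (- 2)) ?_ ?_ ?_
      · simp only [zero_smul, add_zero, map_neg, _root_.neg_apply, neg_neg] at key
        linarith
      · filter_upwards [hnear _ hps e, hnear _ hms (-e)] with σ h1 h2
        refine ((hreg.line1 h1 hτ).sub (hreg.line1 h2 hτ)).sub ?_
        have : HasDerivAt (fun σ : ℝ => (η + σ) * (2 * r - (η + σ))) (2 * r - 2 * (η + σ)) σ := by
          have a1 := (hasDerivAt_id σ).const_add η
          have := a1.mul (a1.const_sub (2 * r))
          refine this.congr_deriv ?_
          simp only [id]; ring
        exact (this.const_mul μ).const_add _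
      · refine ((hreg.line2 (by simpa using hps) hτ).sub
          (hreg.line2 (by simpa using hms) hτ)).sub ?_
        have : HasDerivAt (fun σ : ℝ => 2 * r - 2 * (η + σ)) (-2) 0 := by
          have := (((hasDerivAt_id (0 : ℝ)).const_add η).const_mul 2).const_sub (2 * r)
          simpa using this
        exact this.const_mul μ
      · have hn : ∀ᶠ σ : ℝ in nhds 0, η + σ ∈ Ioo 0 r := by
          have : Filter.Tendsto (fun σ : ℝ => η + σ) (nhds 0) (nhds (η + (0 : ℝ))) :=
            Continuous.tendsto (by fun_prop) 0
          rw [add_zero] at this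
          exact this (isOpen_Ioo.mem_nhds ⟨hη0, hη1⟩)
        filter_upwards [hn] with σ hσ
        have hm : Ψ (x, η + σ, τ) ≤ Ψ (x, η, τ) :=
          hqmax ⟨hx, Ioo_subset_Icc_self hσ, hτ⟩
        simp only [Ψ] at hm
        rw [show x + (η + σ) • e = x + η • e + σ • e by rw [add_smul]; abel,
          show x - (η + σ) • e = x - η • e + σ • (-e) by rw [add_smul, smul_neg]; abel] at hm
        simp only [zero_smul, add_zero]
        linarith
    have dirt : 0 ≤ wt (x + η • e) τ - wt (x - η • e) τ + ω := by
      refine left_deriv_nonneg (g := fun τ' => Ψ (x, η, τ')) hτ' hτ.2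
        (fun s' hs' => hqmax ⟨hx, hη, hs'⟩) ?_
      have a := (hreg.dt _ hps τ hτ).sub (hreg.dt _ hms τ hτ)
      have b : HasDerivWithinAt (fun τ' : ℝ => ω * (‖x - p‖ ^ 2 + (t0 - τ'))
          + μ * (η * (2 * r - η))) (-ω) I τ := by
        have := ((((hasDerivWithinAt_id τ I).const_sub t0).const_add (‖x - p‖ ^ 2)).const_mul
          ω).add_const (μ * (η * (2 * r - η)))
        simpa using this
      have := a.sub b
      rw [sub_neg_eq_add] at this
      exact this
    obtain ⟨ξ, hξ⟩ := psd_decomp (A τ) lam hlam (hell τ hτ) e he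
    have hsymp := hξ (w2 (x + η • e) τ) (fun v v' => hreg.symm hso hps hτ v v')
    have hsymm := hξ (w2 (x - η • e) τ) (fun v v' => hreg.symm hso hms hτ v v')
    let B0 : EE n →L[ℝ] EE n →L[ℝ] ℝ := innerSL ℝ
    have hB0 : ∀ v v', B0 v v' = inner ℝ v v' := fun _ _ => rfl
    have htr := hξ B0 (fun v v' => by rw [hB0, hB0, real_inner_comm])
    have htr2 : con (A τ) B0 ≤ Λ := by
      refine (le_abs_self _).trans ((abs_con_le _ _).trans ?_)
      have h1 : ‖B0‖ ≤ 1 := norm_innerSL_le ℝ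
      have h2 : 0 ≤ ∑ i, ∑ j, |A τ i j| := by positivity
      have h3 := hA τ hτ
      nlinarith
    simp only [hB0, real_inner_self_eq_norm_sq, he] at htr
    have hsum : ∑ k, w2 (x + η • e) τ (ξ k) (ξ k) - ∑ k, w2 (x - η • e) τ (ξ k) (ξ k)
        ≤ 2 * ω * ∑ k, ‖ξ k‖ ^ 2 := by
      rw [← Finset.sum_sub_distrib, Finset.mul_sum]
      exact Finset.sum_le_sum fun k _ => dirx (ξ k)
    have q1 := abs_le.mp (heq τ hτ _ (hmemp x hx η hη))
    have q2 := abs_le.mp (heq τ hτ _ (hmemm x hx η hη))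
    have htr3 : ∑ k, ‖ξ k‖ ^ 2 ≤ Λ := by nlinarith
    have f1 : 2 * ω * ∑ k, ‖ξ k‖ ^ 2 ≤ 2 * ω * Λ := mul_le_mul_of_nonneg_left htr3 (by positivity)
    have f2 := mul_le_mul_of_nonneg_left dirh hlam.le
    rw [hsymp] at q1
    rw [hsymm] at q2
    linarith [q1.1, q2.2, f1, f2, hsum, dirt, hμ2]
  have hfin : Ψ (p, h, t0) ≤ 0 := (hqmax hKn).trans hmaxval
  simp only [Ψ, sub_self, norm_zero] at hfin
  have : μ * (h * (2 * r - h)) ≤ 2 * r * μ * h := by nlinarith [mul_nonneg hμ (sq_nonneg h)]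
  norm_num at hfin
  linarith


lemma dd_taylor {n : ℕ} {s : Set (EE n)} {I : Set ℝ} {u u1 u2 ut}
    (h : Reg (n := n) s I u u1 u2 ut) {y k : EE n} {t κ : ℝ} (ht : t ∈ I)
    (hmem : ∀ σ ∈ Icc (-1 : ℝ) 1, y + σ • k ∈ s)
    (hκ : ∀ σ ∈ Icc (-1 : ℝ) 1, ‖u2 (y + σ • k) t - u2 y t‖ ≤ κ) :
    |dd k u y t - u2 y t k k| ≤ 2 * κ * ‖k‖ ^ 2 := by
  have hmem' : ∀ σ ∈ Icc (0 : ℝ) 1, y + σ • (-k) ∈ s := by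
    intro σ hσ
    have := hmem (-σ) ⟨by linarith [hσ.2], by linarith [hσ.1]⟩
    simpa using this
  have hκ' : ∀ σ ∈ Icc (0 : ℝ) 1, ‖u2 (y + σ • (-k)) t - u2 y t‖ ≤ κ := by
    intro σ hσ
    have := hκ (-σ) ⟨by linarith [hσ.2], by linarith [hσ.1]⟩
    simpa using this
  have hmem2 : ∀ σ ∈ Icc (0 : ℝ) 1, y + σ • k ∈ s :=
    fun σ hσ => hmem σ ⟨by linarith [hσ.1], hσ.2⟩
  have key := taylor_crude
    (fun σ => u (y + σ • k) t + u (y + σ • (-k)) t - (2 * u y t + σ ^ 2 * u2 y t k k))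
    (fun σ => u1 (y + σ • k) t k + u1 (y + σ • (-k)) t (-k) - (2 * σ * u2 y t k k))
    (fun σ => u2 (y + σ • k) t k k + u2 (y + σ • (-k)) t (-k) (-k) - (2 * u2 y t k k))
    (2 * κ * ‖k‖ ^ 2) ?_ ?_ ?_ ?_ ?_
  · have e1 : dd k u y t - u2 y t k k
        = u (y + (1 : ℝ) • k) t + u (y + (1 : ℝ) • (-k)) t
          - (2 * u y t + (1 : ℝ) ^ 2 * u2 y t k k) := by
      simp [dd, sub_eq_add_neg]; ring
    rw [e1]; exact key
  · intro σ hσ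
    refine ((h.line1 (hmem2 σ hσ) ht).add (h.line1 (hmem' σ hσ) ht)).sub ?_
    have := ((hasDerivAt_pow 2 σ).mul_const (u2 y t k k)).const_add (2 * u y t)
    refine this.congr_deriv ?_
    norm_num
  · intro σ hσ
    refine ((h.line2 (hmem2 σ hσ) ht).add (h.line2 (hmem' σ hσ) ht)).sub ?_
    have := ((hasDerivAt_id σ).const_mul 2).mul_const (u2 y t k k)
    refine this.congr_deriv ?_
    norm_num
  · intro σ hσ
    have e1 : u2 (y + σ • k) t k k + u2 (y + σ • (-k)) t (-k) (-k) - (2 * u2 y t k k)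
        = (u2 (y + σ • k) t - u2 y t) k k + (u2 (y + σ • (-k)) t - u2 y t) k k := by
      simp only [map_neg, _root_.neg_apply, neg_neg, _root_.sub_apply]
      ring
    rw [e1]
    have b1 := (u2 (y + σ • k) t - u2 y t).le_opNorm₂ k k
    have b2 := (u2 (y + σ • (-k)) t - u2 y t).le_opNorm₂ k k
    have c1 := hκ σ ⟨by linarith [hσ.1], hσ.2⟩
    have c2 := hκ' σ hσ
    refine (abs_add_le _ _).trans ?_
    rw [Real.norm_eq_abs] at b1 b2
    have := mul_nonneg (norm_nonneg k) (norm_nonneg k)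
    nlinarith
  · simp; ring
  · simp

lemma norm_le_of_quad {n : ℕ} (B : EE n →L[ℝ] EE n →L[ℝ] ℝ) (hB : ∀ v w, B v w = B w v) (m : ℝ)
    (hm0 : 0 ≤ m) (hm : ∀ e, ‖e‖ = 1 → |B e e| ≤ m) : ‖B‖ ≤ m := by
  have hq : ∀ v, |B v v| ≤ m * ‖v‖ ^ 2 := by
    intro v
    rcases eq_or_ne v 0 with rfl | hv
    · simp
    · have hv' : ‖v‖ ≠ 0 := norm_ne_zero_iff.mpr hv
      have h1 := hm (‖v‖⁻¹ • v) (by rw [norm_smul, norm_inv, norm_norm, inv_mul_cancel₀ hv'])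
      simp only [map_smul, _root_.smul_apply, smul_eq_mul] at h1
      rw [← mul_assoc, abs_mul, abs_of_nonneg (by positivity)] at h1
      have hp : 0 < ‖v‖ := by positivity
      have : |B v v| = ‖v‖ ^ 2 * (‖v‖⁻¹ * ‖v‖⁻¹ * |B v v|) := by field_simp
      rw [this]
      nlinarith [sq_nonneg ‖v‖]
  have hpol : ∀ v w, ‖v‖ = 1 → ‖w‖ = 1 → |B v w| ≤ m := by
    intro v w hv hw
    have e1 : B v w = (B (v + w) (v + w) - B (v - w) (v - w)) / 4 := by
      simp only [map_add, map_sub, _root_.add_apply, _root_.sub_apply]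
      rw [hB w v]; ring
    have h1 := hq (v + w)
    have h2 := hq (v - w)
    have h3 := parallelogram_law_with_norm ℝ v w
    rw [hv, hw] at h3
    rw [e1, abs_div]
    have h4 := abs_sub (B (v + w) (v + w)) (B (v - w) (v - w))
    have : |(4 : ℝ)| = 4 := by norm_num
    rw [this, div_le_iff₀ (by norm_num)]
    nlinarith
  refine B.opNorm_le_bound hm0 fun v => ?_
  refine (B v).opNorm_le_bound (by positivity) fun w => ?_
  rcases eq_or_ne v 0 with rfl | hv
  · simp
  rcases eq_or_ne w 0 with rfl | hw
  · simp
  have hv' : ‖v‖ ≠ 0 := norm_ne_zero_iff.mpr hv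
  have hw' : ‖w‖ ≠ 0 := norm_ne_zero_iff.mpr hw
  have h1 := hpol (‖v‖⁻¹ • v) (‖w‖⁻¹ • w)
    (by rw [norm_smul, norm_inv, norm_norm, inv_mul_cancel₀ hv'])
    (by rw [norm_smul, norm_inv, norm_norm, inv_mul_cancel₀ hw'])
  simp only [map_smul, _root_.smul_apply, smul_eq_mul] at h1
  rw [← mul_assoc, abs_mul, abs_of_nonneg (by positivity)] at h1
  have hp : 0 < ‖v‖ := by positivity
  have hp' : 0 < ‖w‖ := by positivity
  rw [Real.norm_eq_abs]
  have : |B v w| = ‖v‖ * ‖w‖ * (‖w‖⁻¹ * ‖v‖⁻¹ * |B v w|) := by field_simp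
  rw [this]
  have h5 : 0 < ‖v‖ * ‖w‖ := by positivity
  nlinarith

/-- local hypotheses on the cylinder of radius `D` -/
structure Loc {n : ℕ} (α lam Λ : ℝ) (x0 : EE n) (t0 D K S2 KF : ℝ)
    (a : Fin n → Fin n → EE n → ℝ → ℝ) (u : EE n → ℝ → ℝ)
    (u1 : EE n → ℝ → EE n →L[ℝ] ℝ) (u2 : EE n → ℝ → EE n →L[ℝ] EE n →L[ℝ] ℝ)
    (ut : EE n → ℝ → ℝ) : Prop where
  reg : Reg (ball x0 D) (Icc (t0 - D ^ 2) t0) u u1 u2 ut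
  ell : ∀ t ∈ Icc (t0 - D ^ 2) t0, ∀ y ∈ ball x0 D, ∀ ξ : Fin n → ℝ,
      lam * (∑ i, ξ i ^ 2) ≤ ∑ i, ∑ j, a i j y t * ξ i * ξ j
  bdd : ∀ t ∈ Icc (t0 - D ^ 2) t0, ∀ y ∈ ball x0 D, ∑ i, ∑ j, |a i j y t| ≤ Λ
  hol : ∀ t ∈ Icc (t0 - D ^ 2) t0, ∀ y ∈ ball x0 D, ∀ y' ∈ ball x0 D,
    ∑ i, ∑ j, |a i j y t - a i j y' t| ≤ Λ * ‖y - y'‖ ^ α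
  hK : ∀ t ∈ Icc (t0 - D ^ 2) t0, ∀ y ∈ ball x0 D, ∀ y' ∈ ball x0 D,
    ‖u2 y t - u2 y' t‖ ≤ K * ‖y - y'‖ ^ α
  hS : ∀ t ∈ Icc (t0 - D ^ 2) t0, ∀ y ∈ ball x0 D, ‖u2 y t‖ ≤ S2
  hF : ∀ t ∈ Icc (t0 - D ^ 2) t0, ∀ y ∈ ball x0 D, ∀ y' ∈ ball x0 D,
    |(ut y t - con (fun i j => a i j y t) (u2 y t))
      - (ut y' t - con (fun i j => a i j y' t) (u2 y' t))| ≤ KF * ‖y - y'‖ ^ α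

lemma rpow_mul_le {x c α : ℝ} (hx : 0 ≤ x) (hc : 1 ≤ c) (hα : α ∈ Ioo (0 : ℝ) 1) :
    (c * x) ^ α ≤ c * x ^ α := by
  rw [Real.mul_rpow (by linarith) hx]
  refine mul_le_mul_of_nonneg_right ?_ (by positivity)
  calc c ^ α ≤ c ^ (1 : ℝ) := Real.rpow_le_rpow_of_exponent_le hc hα.2.le
    _ = c := Real.rpow_one c

lemma Loc.dd_near {n : ℕ} {α lam Λ : ℝ} {x0 : EE n} {t0 D K S2 KF : ℝ} {a u u1 u2 ut}
    (hL : Loc α lam Λ x0 t0 D K S2 KF a u u1 u2 ut) (hα : α ∈ Ioo (0 : ℝ) 1) (hK : 0 < K)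
    {y k : EE n} {t : ℝ} (ht : t ∈ Icc (t0 - D ^ 2) t0) (hy : ‖y - x0‖ + ‖k‖ < D) :
    |dd k u y t - u2 y t k k| ≤ 2 * (K * ‖k‖ ^ α) * ‖k‖ ^ 2 := by
  have hyD : y ∈ ball x0 D := by
    rw [mem_ball, dist_eq_norm]; linarith [norm_nonneg k]
  have hmem : ∀ σ ∈ Icc (-1 : ℝ) 1, ‖σ • k‖ ≤ ‖k‖ := by
    intro σ hσ
    rw [norm_smul, Real.norm_eq_abs]
    have := abs_le.mpr hσ
    nlinarith [norm_nonneg k]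
  have hmem2 : ∀ σ ∈ Icc (-1 : ℝ) 1, y + σ • k ∈ ball x0 D := by
    intro σ hσ
    rw [mem_ball, dist_eq_norm, show y + σ • k - x0 = (y - x0) + σ • k by abel]
    have := hmem σ hσ
    linarith [norm_add_le (y - x0) (σ • k)]
  refine dd_taylor hL.reg ht hmem2 fun σ hσ => ?_
  refine (hL.hK t ht _ (hmem2 σ hσ) _ hyD).trans ?_
  refine mul_le_mul_of_nonneg_left ?_ hK.le
  rw [add_sub_cancel_left]
  exact Real.rpow_le_rpow (norm_nonneg _) (hmem σ hσ) hα.1.le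

lemma con_dd {n : ℕ} (A : Fin n → Fin n → ℝ) (k : EE n)
    (u2 : EE n → ℝ → EE n →L[ℝ] EE n →L[ℝ] ℝ) (y : EE n) (t : ℝ) :
    con A (dd k u2 y t) = con A (u2 (y + k) t) + con A (u2 (y - k) t) - 2 * con A (u2 y t) := by
  unfold dd
  rw [con_sub_right, con_add_right, con_smul_right]

lemma Loc.frozen_diff {n : ℕ} {α lam Λ : ℝ} {x0 : EE n} {t0 D K S2 KF : ℝ} {a u u1 u2 ut}
    (hL : Loc α lam Λ x0 t0 D K S2 KF a u u1 u2 ut) (hK : 0 < K)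
    (hΛ : 0 < Λ) {p y y' : EE n} {t ρ : ℝ} (ht : t ∈ Icc (t0 - D ^ 2) t0) (hp : p ∈ ball x0 D)
    (hy : y ∈ ball x0 D) (hy' : y' ∈ ball x0 D) (hρ : ‖y' - p‖ ^ α ≤ ρ) :
    |(ut y' t - con (fun i j => a i j p t) (u2 y' t))
      - (ut y t - con (fun i j => a i j p t) (u2 y t))|
      ≤ (KF + Λ * S2 + Λ * ρ * K) * ‖y' - y‖ ^ α := by
  have e1 : (ut y' t - con (fun i j => a i j p t) (u2 y' t))
      - (ut y t - con (fun i j => a i j p t) (u2 y t))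
      = ((ut y' t - con (fun i j => a i j y' t) (u2 y' t))
      - (ut y t - con (fun i j => a i j y t) (u2 y t)))
      + con (fun i j => a i j y' t - a i j y t) (u2 y t)
      + con (fun i j => a i j y' t - a i j p t) (u2 y' t - u2 y t) := by
    rw [con_sub_left, con_sub_left, con_sub_right, con_sub_right]; ring
  rw [e1]
  have b1 := hL.hF t ht y' hy' y hy
  have b2 := abs_con_le (fun i j => a i j y' t - a i j y t) (u2 y t)
  have b3 := abs_con_le (fun i j => a i j y' t - a i j p t) (u2 y' t - u2 y t)
  have c2 := hL.hol t ht y' hy' y hy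
  have c3 := hL.hol t ht y' hy' p hp
  have d2 := hL.hS t ht y hy
  have d3 := hL.hK t ht y' hy' y hy
  have hpos : 0 ≤ ‖y' - y‖ ^ α := by positivity
  have hρ0 : 0 ≤ ρ := le_trans (by positivity) hρ
  have f2 : |con (fun i j => a i j y' t - a i j y t) (u2 y t)| ≤ (Λ * ‖y' - y‖ ^ α) * S2 :=
    b2.trans (mul_le_mul c2 d2 (norm_nonneg (u2 y t)) (mul_nonneg hΛ.le hpos))
  have f3 : |con (fun i j => a i j y' t - a i j p t) (u2 y' t - u2 y t)|
      ≤ (Λ * ρ) * (K * ‖y' - y‖ ^ α) :=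
    b3.trans (mul_le_mul (c3.trans (mul_le_mul_of_nonneg_left hρ hΛ.le)) d3
      (norm_nonneg (u2 y' t - u2 y t)) (mul_nonneg hΛ.le hρ0))
  have t1 := abs_add_le (((ut y' t - con (fun i j => a i j y' t) (u2 y' t))
      - (ut y t - con (fun i j => a i j y t) (u2 y t)))
      + con (fun i j => a i j y' t - a i j y t) (u2 y t))
      (con (fun i j => a i j y' t - a i j p t) (u2 y' t - u2 y t))
  have t2 := abs_add_le ((ut y' t - con (fun i j => a i j y' t) (u2 y' t))
      - (ut y t - con (fun i j => a i j y t) (u2 y t)))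
      (con (fun i j => a i j y' t - a i j y t) (u2 y t))
  linarith

set_option maxHeartbeats 1000000 in
lemma third_diff {n : ℕ} {α lam Λ : ℝ} (hα : α ∈ Ioo (0 : ℝ) 1) (hlam : 0 < lam) (hΛ : 0 < Λ) :
    ∃ C1 : ℝ, 0 < C1 ∧ ∀ (x0 : EE n) (t0 D K S2 KF : ℝ) (a) (u) (u1) (u2) (ut),
      0 < K → 0 ≤ S2 → 0 ≤ KF → Loc α lam Λ x0 t0 D K S2 KF a u u1 u2 ut →
      ∀ (N σ L : ℝ), 1 ≤ N → 0 < σ → L + 2 * (N * σ) + σ < D →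
      ∀ k : EE n, ‖k‖ = σ → ∀ y y' : EE n, ‖y - x0‖ ≤ L → ‖y' - x0‖ ≤ L → ‖y - y'‖ ≤ 2 * σ →
      dd k u y t0 - dd k u y' t0 ≤
        C1 * (N ^ α / N * K + N * (KF + S2 + (N * σ) ^ α * K)) * (σ ^ 2 * σ ^ α) := by
  refine ⟨16 * (1 + (1 + Λ) / lam) + 4 * (1 + 3 * Λ) / lam, by positivity, ?_⟩
  intro x0 t0 D K S2 KF a u u1 u2 ut hK hS2 hKF hL N σ L hN hσ hLD k hk y y' hy hy' hyy
  have hN0 : 0 < N := by linarith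
  have hP : 0 < σ ^ α := by positivity
  have hQ : 0 < N ^ α := by positivity
  have hL0 : 0 ≤ L := (norm_nonneg _).trans hy
  rcases eq_or_ne y y' with rfl | hne
  · rw [sub_self]; positivity
  set r := N * σ with hr
  have hr0 : 0 < r := by positivity
  have hσr : σ ≤ r := by nlinarith
  have hrα : r ^ α = N ^ α * σ ^ α := by rw [hr, Real.mul_rpow hN0.le hσ.le]
  have hd0 : 0 < ‖y - y'‖ := norm_pos_iff.mpr (sub_ne_zero.mpr hne)
  set h := ‖y - y'‖ / 2 with hh
  set e : EE n := ‖y - y'‖⁻¹ • (y - y') with hedef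
  have he : ‖e‖ = 1 := by
    rw [hedef, norm_smul, norm_inv, norm_norm, inv_mul_cancel₀ hd0.ne']
  set p : EE n := (1 / 2 : ℝ) • (y + y') with hpdef
  have hhe : h • e = (1 / 2 : ℝ) • (y - y') := by
    rw [hh, hedef, smul_smul]; congr 1; field_simp
  have hpy : p + h • e = y := by
    rw [hhe, hpdef, ← smul_add, show y + y' + (y - y') = (2 : ℝ) • y by rw [two_smul]; abel,
      smul_smul]
    norm_num
  have hpy' : p - h • e = y' := by
    rw [hhe, hpdef, ← smul_sub, show y + y' - (y - y') = (2 : ℝ) • y' by rw [two_smul]; abel,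
      smul_smul]
    norm_num
  have hpx : ‖p - x0‖ ≤ L := by
    have : p - x0 = (1 / 2 : ℝ) • ((y - x0) + (y' - x0)) := by
      rw [hpdef, show (y - x0) + (y' - x0) = (y + y') - (2 : ℝ) • x0 by rw [two_smul]; abel,
        smul_sub, smul_smul]
      norm_num
    rw [this, norm_smul]
    have := norm_add_le (y - x0) (y' - x0)
    norm_num
    linarith
  have hsub : ∀ z ∈ closedBall p (2 * r), ‖z - x0‖ ≤ L + 2 * r := by
    intro z hz
    rw [mem_closedBall, dist_eq_norm] at hz
    have := norm_add_le (z - p) (p - x0)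
    rw [sub_add_sub_cancel] at this
    linarith
  have hI : Icc (t0 - r ^ 2) t0 ⊆ Icc (t0 - D ^ 2) t0 := by
    apply Icc_subset_Icc_left
    nlinarith
  have hballp : ∀ z ∈ ball x0 (D - σ), z + k ∈ ball x0 D := by
    intro z hz
    rw [mem_ball, dist_eq_norm] at hz ⊢
    rw [show z + k - x0 = (z - x0) + k by abel]
    linarith [norm_add_le (z - x0) k]
  have hballm : ∀ z ∈ ball x0 (D - σ), z - k ∈ ball x0 D := by
    intro z hz
    rw [mem_ball, dist_eq_norm] at hz ⊢
    rw [show z - k - x0 = (z - x0) - k by abel]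
    linarith [norm_sub_le (z - x0) k]
  have hball0 : ∀ z ∈ ball x0 (D - σ), z ∈ ball x0 D := fun z hz => ball_subset_ball (by linarith) hz
  have hreg : Reg (ball x0 (D - σ)) (Icc (t0 - r ^ 2) t0) (dd k u) (dd k u1) (dd k u2) (dd k ut) :=
    (hL.reg.mono subset_rfl hI).dd k hball0 hballp hballm
  have hcb : closedBall p (2 * r) ⊆ ball x0 (D - σ) := by
    intro z hz
    rw [mem_ball, dist_eq_norm]
    linarith [hsub z hz]
  have hpD : p ∈ ball x0 D := by
    rw [mem_ball, dist_eq_norm]; linarith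
  set W := 8 * K * r ^ α * σ ^ 2 with hWdef
  set Γ := 2 * σ ^ α * (KF + Λ * S2 + 3 * Λ * r ^ α * K) with hΓdef
  have hW : 0 < W := by positivity
  have hΓ : 0 ≤ Γ := by positivity
  set μ := W / r ^ 2 + (2 * Γ + W / r ^ 2 * (2 + 2 * Λ)) / (2 * lam) with hμdef
  have hWr : 0 < W / r ^ 2 := by positivity
  have key := grad_est (n := n) (lam := lam) (Λ := Λ) (r := r) (Γ := Γ) (W := W) (μ := μ) hlam hr0
    hW.le (p := p) (t0 := t0) (s := ball x0 (D - σ)) isOpen_ball hcb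
    (A := fun t i j => a i j p t) (fun t ht => hL.ell t (hI ht) p hpD)
    (fun t ht => hL.bdd t (hI ht) p hpD) hreg ?_ ?_ ?_ ?_ he (h := h)
    ⟨by positivity, by rw [hh]; linarith⟩
  · rw [hpy, hpy'] at key
    refine key.trans ?_
    have hhσ : h ≤ σ := by rw [hh]; linarith
    have hμ0 : 0 ≤ μ := by positivity
    have s1 : 2 * r * μ * h ≤ 2 * r * μ * σ := mul_le_mul_of_nonneg_left hhσ (by positivity)
    refine s1.trans ?_
    have e1 : 2 * r * μ * σ = 16 * (1 + (1 + Λ) / lam) * (N ^ α / N * K) * (σ ^ 2 * σ ^ α)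
        + 4 / lam * N * (KF + Λ * S2 + 3 * Λ * r ^ α * K) * (σ ^ 2 * σ ^ α) := by
      rw [hμdef, hWdef, hΓdef, hrα, hr]
      field_simp
      ring
    rw [e1]
    have e2 : KF + Λ * S2 + 3 * Λ * r ^ α * K ≤ (1 + 3 * Λ) * (KF + S2 + r ^ α * K) := by
      have : 0 ≤ r ^ α * K := by positivity
      nlinarith [mul_nonneg hΛ.le hKF, mul_nonneg hΛ.le hS2]
    have e3 : 4 / lam * N * (KF + Λ * S2 + 3 * Λ * r ^ α * K)
        ≤ 4 / lam * N * ((1 + 3 * Λ) * (KF + S2 + r ^ α * K)) :=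
      mul_le_mul_of_nonneg_left e2 (by positivity)
    have g1 : 0 ≤ 16 * (1 + (1 + Λ) / lam) := by positivity
    have g2 : 0 ≤ 4 * (1 + 3 * Λ) / lam := by positivity
    have g3 : 0 ≤ N ^ α / N * K := by positivity
    have g4 : 0 ≤ N * (KF + S2 + r ^ α * K) := by positivity
    rw [← add_mul]
    refine mul_le_mul_of_nonneg_right ?_ (by positivity)
    have e4 : 4 / lam * N * ((1 + 3 * Λ) * (KF + S2 + r ^ α * K))
      = 4 * (1 + 3 * Λ) / lam * (N * (KF + S2 + r ^ α * K)) := by ring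
    rw [e4] at e3
    nlinarith [mul_nonneg g1 g4, mul_nonneg g2 g3]
  · intro t ht z hz z' hz'
    have hzx := hsub z hz
    have hzx' := hsub z' hz'
    have b1 := abs_le.mp (hL.dd_near hα hK (y := z) (k := k) (hI ht) (by linarith))
    have b2 := abs_le.mp (hL.dd_near hα hK (y := z') (k := k) (hI ht) (by linarith))
    have b3 := hL.hK t (hI ht) z (hball0 z (hcb hz)) z' (hball0 z' (hcb hz'))
    have b4 := (u2 z t - u2 z' t).le_opNorm₂ k k
    rw [Real.norm_eq_abs] at b4
    have b5 := (le_abs_self _).trans b4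
    simp only [_root_.sub_apply] at b5
    have hzz : ‖z - z'‖ ≤ 4 * r := by
      rw [mem_closedBall] at hz hz'
      rw [← dist_eq_norm]
      linarith [dist_triangle_right z z' p]
    have b6 : ‖z - z'‖ ^ α ≤ 4 * r ^ α :=
      (Real.rpow_le_rpow (norm_nonneg _) hzz hα.1.le).trans
        (rpow_mul_le hr0.le (by norm_num) hα)
    have b7 : σ ^ α ≤ r ^ α := Real.rpow_le_rpow hσ.le hσr hα.1.le
    rw [hk] at b1 b2 b5
    have b8 : ‖u2 z t - u2 z' t‖ * σ * σ ≤ (K * (4 * r ^ α)) * σ * σ := by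
      gcongr
      exact b3.trans (by gcongr)
    have b9 : 2 * (K * σ ^ α) * σ ^ 2 ≤ 2 * (K * r ^ α) * σ ^ 2 := by gcongr
    rw [hWdef]
    nlinarith [b1.2, b2.1]
  · intro t ht z hz
    have hzx := hsub z hz
    rw [con_dd]
    have hz0 := hball0 z (hcb hz)
    have hzp := hballp z (hcb hz)
    have hzm := hballm z (hcb hz)
    have hzp' : ‖z - p‖ ≤ 2 * r := by rw [← dist_eq_norm]; exact hz
    have q1 : ‖z + k - p‖ ^ α ≤ 3 * r ^ α := by
      refine (Real.rpow_le_rpow (norm_nonneg _) (?_ : _ ≤ 3 * r) hα.1.le).trans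
        (rpow_mul_le hr0.le (by norm_num) hα)
      rw [show z + k - p = (z - p) + k by abel]
      linarith [norm_add_le (z - p) k]
    have q2 : ‖z - k - p‖ ^ α ≤ 3 * r ^ α := by
      refine (Real.rpow_le_rpow (norm_nonneg _) (?_ : _ ≤ 3 * r) hα.1.le).trans
        (rpow_mul_le hr0.le (by norm_num) hα)
      rw [show z - k - p = (z - p) - k by abel]
      linarith [norm_sub_le (z - p) k]
    have f1 := hL.frozen_diff hK hΛ (hI ht) hpD hz0 hzp q1
    have f2 := hL.frozen_diff hK hΛ (hI ht) hpD hz0 hzm q2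
    rw [add_sub_cancel_left, hk] at f1
    rw [show z - k - z = -k by abel, norm_neg, hk] at f2
    have f1 := abs_le.mp f1
    have f2 := abs_le.mp f2
    rw [hΓdef]
    simp only [dd, smul_eq_mul]
    rw [abs_le]
    constructor
    · nlinarith [f1.1, f2.1]
    · nlinarith [f1.2, f2.2]
  · have : W = W / r ^ 2 * r ^ 2 := by field_simp
    nth_rewrite 1 [this]
    refine mul_le_mul_of_nonneg_right ?_ (by positivity)
    rw [hμdef]
    have : 0 ≤ (2 * Γ + W / r ^ 2 * (2 + 2 * Λ)) / (2 * lam) := by positivity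
    linarith
  · have : 2 * lam * μ = 2 * lam * (W / r ^ 2) + (2 * Γ + W / r ^ 2 * (2 + 2 * Λ)) := by
      rw [hμdef]; field_simp
    rw [this]
    nlinarith [mul_pos hlam hWr]


lemma dd_double {n : ℕ} (u : EE n → ℝ → ℝ) (k x : EE n) (t : ℝ) :
    dd ((2 : ℝ) • k) u x t - 4 * dd k u x t
      = (dd k u (x + k) t - dd k u x t) + (dd k u (x - k) t - dd k u x t) := by
  unfold dd
  rw [two_smul, show x + (k + k) = x + k + k by abel, show x - (k + k) = x - k - k by abel,
    show x + k - k = x by abel, show x - k + k = x by abel]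
  simp only [smul_eq_mul]
  ring

lemma core_osc {n : ℕ} {α lam Λ : ℝ} (hα : α ∈ Ioo (0 : ℝ) 1) (hlam : 0 < lam) (hΛ : 0 < Λ) :
    ∃ C2 : ℝ, 0 < C2 ∧ ∀ (x0 : EE n) (t0 D K S2 KF : ℝ) (a) (u) (u1) (u2) (ut),
      0 < K → 0 ≤ S2 → 0 ≤ KF → Loc α lam Λ x0 t0 D K S2 KF a u u1 u2 ut →
      ∀ (N τ : ℝ), 1 ≤ N → 0 < τ → 8 * (N * τ) ≤ D → ∀ h : EE n, ‖h‖ = τ →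
      ‖u2 (x0 + h) t0 - u2 x0 t0‖ ≤
        C2 * (N ^ α / N * K + N * (KF + S2 + (N * τ) ^ α * K)) * τ ^ α := by
  obtain ⟨C1, hC1, H⟩ := third_diff (n := n) hα hlam hΛ
  set θ : ℝ := (2 : ℝ) ^ (-α) with hθ
  have hθ0 : 0 < θ := by positivity
  have hθ1 : θ < 1 := Real.rpow_lt_one_of_one_lt_of_neg (by norm_num) (by linarith [hα.1])
  have h1θ : 0 < 1 - θ := by linarith
  refine ⟨C1 * (1 / (1 - θ) + 1), by positivity, ?_⟩
  intro x0 t0 D K S2 KF a u u1 u2 ut hK hS2 hKF hL N τ hN hτ hND h hh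
  have hN0 : 0 < N := by linarith
  have hNτ : τ ≤ N * τ := by nlinarith
  have hD : 0 < D := by nlinarith
  have ht0 : t0 ∈ Icc (t0 - D ^ 2) t0 := ⟨by nlinarith [sq_nonneg D], le_rfl⟩
  set E := C1 * (N ^ α / N * K + N * (KF + S2 + (N * τ) ^ α * K)) with hE
  have hE0 : 0 ≤ E := by positivity
  -- third differences at scales at most τ
  have T : ∀ k : EE n, 0 < ‖k‖ → ‖k‖ ≤ τ → ∀ y y' : EE n, ‖y - x0‖ ≤ 2 * τ → ‖y' - x0‖ ≤ 2 * τ →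
      ‖y - y'‖ ≤ 2 * ‖k‖ → |dd k u y t0 - dd k u y' t0| ≤ E * (‖k‖ ^ 2 * ‖k‖ ^ α) := by
    intro k hk0 hkτ y y' hy hy' hyy
    have hNk : N * ‖k‖ ≤ N * τ := by gcongr
    have hE' : C1 * (N ^ α / N * K + N * (KF + S2 + (N * ‖k‖) ^ α * K)) * (‖k‖ ^ 2 * ‖k‖ ^ α)
        ≤ E * (‖k‖ ^ 2 * ‖k‖ ^ α) := by
      rw [hE]
      have : (N * ‖k‖) ^ α ≤ (N * τ) ^ α := Real.rpow_le_rpow (by positivity) hNk hα.1.le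
      gcongr
    have A := H x0 t0 D K S2 KF a u u1 u2 ut hK hS2 hKF hL N ‖k‖ (2 * τ) hN hk0 (by linarith) k rfl
    rw [abs_le]
    have a1 := A y y' hy hy' hyy
    have a2 := A y' y hy' hy (by rwa [norm_sub_rev])
    constructor <;> linarith
  -- second difference versus second derivative
  have Q : ∀ e : EE n, ‖e‖ = 1 → ∀ x : EE n, ‖x - x0‖ ≤ τ →
      |dd (τ • e) u x t0 - τ ^ 2 * u2 x t0 e e| ≤ (E / 2) / (1 - θ) * (τ ^ 2 * τ ^ α) := by
    intro e he x hx
    have hn : ∀ σ : ℝ, 0 < σ → ‖σ • e‖ = σ := by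
      intro σ hσ; rw [norm_smul, he, Real.norm_eq_abs, abs_of_pos hσ, mul_one]
    have key := contraction_const (ι := {σ : ℝ // 0 < σ ∧ σ ≤ τ})
      (fun σ => |dd (σ.1 • e) u x t0 - σ.1 ^ 2 * u2 x t0 e e|) (fun σ => σ.1 ^ 2 * σ.1 ^ α)
      θ (E / 2) hθ0.le hθ1 (by positivity) ?_ ⟨2 * K, by positivity, ?_⟩ ?_
    · exact key ⟨τ, hτ, le_rfl⟩
    · rintro B hB hall ⟨σ, hσ0, hστ⟩
      have b := hall ⟨σ / 2, by positivity, by linarith⟩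
      simp only at b ⊢
      have hk : ‖(σ / 2) • e‖ = σ / 2 := hn _ (by positivity)
      have d := dd_double u ((σ / 2) • e) x t0
      rw [smul_smul, show 2 * (σ / 2) = σ by ring] at d
      have r1 := T ((σ / 2) • e) (by rw [hk]; positivity) (by rw [hk]; linarith)
        (x + (σ / 2) • e) x (by
          rw [show x + (σ / 2) • e - x0 = (x - x0) + (σ / 2) • e by abel]
          have := norm_add_le (x - x0) ((σ / 2) • e)
          rw [hk] at this; linarith) (by linarith) (by
          rw [add_sub_cancel_left, hk]; linarith)
      have r2 := T ((σ / 2) • e) (by rw [hk]; positivity) (by rw [hk]; linarith)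
        (x - (σ / 2) • e) x (by
          rw [show x - (σ / 2) • e - x0 = (x - x0) - (σ / 2) • e by abel]
          have := norm_sub_le (x - x0) ((σ / 2) • e)
          rw [hk] at this; linarith) (by linarith) (by
          rw [show x - (σ / 2) • e - x = -((σ / 2) • e) by abel, norm_neg, hk]; linarith)
      rw [hk] at r1 r2
      have hpw : (σ / 2) ^ α = θ * σ ^ α := by
        rw [Real.div_rpow hσ0.le (by norm_num), hθ, Real.rpow_neg (by norm_num)]
        field_simp
      rw [hpw] at b r1 r2
      have hPσ : 0 < σ ^ 2 * σ ^ α := by positivity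
      have hEP : 0 ≤ E * (σ ^ 2 * σ ^ α) := by positivity
      have hθE : θ * (E * (σ ^ 2 * σ ^ α)) ≤ E * (σ ^ 2 * σ ^ α) := by nlinarith
      have b' := abs_le.mp b
      have r1' := abs_le.mp r1
      have r2' := abs_le.mp r2
      have m1 : B * ((σ / 2) ^ 2 * (θ * σ ^ α)) = θ * B * (σ ^ 2 * σ ^ α) / 4 := by ring
      have m2 : E * ((σ / 2) ^ 2 * (θ * σ ^ α)) = θ * (E * (σ ^ 2 * σ ^ α)) / 4 := by ring
      rw [m1] at b'
      rw [m2] at r1' r2'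
      rw [abs_le, add_mul]
      have m3 : (σ / 2) ^ 2 * (u2 x t0 e) e = σ ^ 2 * (u2 x t0 e) e / 4 := by ring
      rw [m3] at b'
      constructor
      · linarith [b'.1, r1'.1, r2'.1]
      · linarith [b'.2, r1'.2, r2'.2]
    · rintro ⟨σ, hσ0, hστ⟩
      have := hL.dd_near hα hK (y := x) (k := σ • e) ht0 (by rw [hn σ hσ0]; linarith)
      rw [hn σ hσ0] at this
      simp only [map_smul, _root_.smul_apply, smul_eq_mul] at this ⊢
      rw [← mul_assoc, ← pow_two] at this
      linarith
    · rintro ⟨σ, hσ0, hστ⟩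
      simp only
      positivity
  have hx0 : x0 ∈ ball x0 D := mem_ball_self hD
  have hxh : x0 + h ∈ ball x0 D := by
    rw [mem_ball, dist_eq_norm, add_sub_cancel_left, hh]; linarith
  refine norm_le_of_quad _ ?_ _ (by positivity) ?_
  · intro v w
    rw [_root_.sub_apply, _root_.sub_apply, _root_.sub_apply, _root_.sub_apply,
      hL.reg.symm isOpen_ball hx0 ht0 v w, hL.reg.symm isOpen_ball hxh ht0 v w]
  · intro e he
    have q1 := abs_le.mp (Q e he (x0 + h) (by rw [add_sub_cancel_left, hh]))
    have q2 := abs_le.mp (Q e he x0 (by rw [sub_self, norm_zero]; exact hτ.le))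
    have hne : ‖τ • e‖ = τ := by rw [norm_smul, he, Real.norm_eq_abs, abs_of_pos hτ, mul_one]
    have q3 := abs_le.mp (T (τ • e) (by rw [hne]; exact hτ) hne.le (x0 + h) x0
      (by rw [add_sub_cancel_left, hh]; linarith) (by rw [sub_self, norm_zero]; positivity)
      (by rw [add_sub_cancel_left, hh, hne]; linarith))
    rw [hne] at q3
    simp only [_root_.sub_apply]
    have hτ2 : 0 < τ ^ 2 := by positivity
    have tot : τ ^ 2 * |u2 (x0 + h) t0 e e - u2 x0 t0 e e|
        ≤ τ ^ 2 * ((E * (1 / (1 - θ) + 1)) * τ ^ α) := by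
      have e1 : τ ^ 2 * |u2 (x0 + h) t0 e e - u2 x0 t0 e e|
        = |τ ^ 2 * u2 (x0 + h) t0 e e - τ ^ 2 * u2 x0 t0 e e| := by
          rw [← mul_sub, abs_mul, abs_of_pos hτ2]
      have e2 : τ ^ 2 * ((E * (1 / (1 - θ) + 1)) * τ ^ α)
        = 2 * ((E / 2) / (1 - θ) * (τ ^ 2 * τ ^ α)) + E * (τ ^ 2 * τ ^ α) := by ring
      rw [e1, e2, abs_le]
      constructor
      · linarith [q1.1, q1.2, q2.1, q2.2, q3.1, q3.2]
      · linarith [q1.1, q1.2, q2.1, q2.2, q3.1, q3.2]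
    have := le_of_mul_le_mul_left tot hτ2
    refine this.trans (le_of_eq ?_)
    rw [hE]; ring


/-- interpolation of first and second derivatives -/
lemma interp {n : ℕ} {s : Set (EE n)} {I : Set ℝ} {u u1 u2 ut}
    (h : Reg (n := n) s I u u1 u2 ut) (hs : IsOpen s) {y : EE n} {t η κ M : ℝ} (ht : t ∈ I)
    (hη : 0 < η) (hmem : closedBall y η ⊆ s) (hM : ∀ z ∈ s, |u z t| ≤ M)
    (hκ : ∀ z ∈ closedBall y η, ‖u2 z t - u2 y t‖ ≤ κ) :
    ‖u2 y t‖ ≤ 4 * M / η ^ 2 + 2 * κ ∧ ‖u1 y t‖ ≤ 2 * M / η + η * (‖u2 y t‖ + κ) := by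
  have hy : y ∈ s := hmem (mem_closedBall_self hη.le)
  have hM0 : 0 ≤ M := (abs_nonneg _).trans (hM y hy)
  have hκ0 : 0 ≤ κ := (norm_nonneg (u2 y t - u2 y t)).trans (hκ y (mem_closedBall_self hη.le))
  have hball : ∀ e : EE n, ‖e‖ = 1 → ∀ σ ∈ Icc (-1 : ℝ) 1, y + σ • (η • e) ∈ closedBall y η := by
    intro e he σ hσ
    rw [mem_closedBall, dist_eq_norm, add_sub_cancel_left, norm_smul, norm_smul, he,
      Real.norm_eq_abs, Real.norm_eq_abs, abs_of_pos hη, mul_one]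
    have := abs_le.mpr hσ
    nlinarith
  have hn : ∀ e : EE n, ‖e‖ = 1 → ‖η • e‖ = η := by
    intro e he; rw [norm_smul, he, Real.norm_eq_abs, abs_of_pos hη, mul_one]
  constructor
  · refine norm_le_of_quad _ (fun v w => h.symm hs hy ht v w) _ (by positivity) fun e he => ?_
    have h1 := dd_taylor h (k := η • e) ht (fun σ hσ => hmem (hball e he σ hσ))
      (fun σ hσ => hκ _ (hball e he σ hσ))
    rw [hn e he] at h1
    simp only [map_smul, _root_.smul_apply, smul_eq_mul] at h1
    have p1 := abs_le.mp (hM _ (hmem (hball e he 1 (by simp))))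
    have p2 := abs_le.mp (hM _ (hmem (hball e he (-1) (by simp))))
    have p3 := abs_le.mp (hM _ hy)
    rw [one_smul] at p1
    rw [neg_one_smul, ← sub_eq_add_neg] at p2
    have hd : |dd (η • e) u y t| ≤ 4 * M := by
      unfold dd
      rw [abs_le, smul_eq_mul]
      constructor
      · linarith [p1.1, p2.1, p3.2]
      · linarith [p1.2, p2.2, p3.1]
    have h1' := abs_le.mp h1
    have hd' := abs_le.mp hd
    have hη2 : 0 < η ^ 2 := by positivity
    have : η ^ 2 * |u2 y t e e| ≤ η ^ 2 * (4 * M / η ^ 2 + 2 * κ) := by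
      have e1 : η ^ 2 * (4 * M / η ^ 2 + 2 * κ) = 4 * M + 2 * κ * η ^ 2 := by field_simp
      have e2 : η ^ 2 * |u2 y t e e| = |η * (η * u2 y t e e)| := by
        rw [← mul_assoc, ← pow_two, abs_mul, abs_of_pos hη2]
      rw [e1, e2, abs_le]
      constructor
      · linarith [h1'.1, h1'.2, hd'.1, hd'.2]
      · linarith [h1'.1, h1'.2, hd'.1, hd'.2]
    exact le_of_mul_le_mul_left this hη2
  · refine (u1 y t).opNorm_le_of_unit_norm (by positivity) fun e he => ?_
    have hb : ∀ σ ∈ Icc (0 : ℝ) 1, y + σ • (η • e) ∈ closedBall y η :=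
      fun σ hσ => hball e he σ ⟨by linarith [hσ.1], hσ.2⟩
    have key := taylor_crude (fun σ => u (y + σ • (η • e)) t - (u y t + σ * u1 y t (η • e)))
      (fun σ => u1 (y + σ • (η • e)) t (η • e) - u1 y t (η • e))
      (fun σ => u2 (y + σ • (η • e)) t (η • e) (η • e)) (η ^ 2 * (‖u2 y t‖ + κ)) ?_ ?_ ?_ ?_ ?_
    · simp only [one_smul, one_mul, map_smul, smul_eq_mul] at key
      have p1 := abs_le.mp (hM _ (hmem (hball e he 1 (by simp))))
      have p3 := abs_le.mp (hM _ hy)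
      rw [one_smul] at p1
      have k' := abs_le.mp key
      have : η * |u1 y t e| ≤ η * (2 * M / η + η * (‖u2 y t‖ + κ)) := by
        have e1 : η * (2 * M / η + η * (‖u2 y t‖ + κ)) = 2 * M + η ^ 2 * (‖u2 y t‖ + κ) := by
          field_simp
        have e2 : η * |u1 y t e| = |η * u1 y t e| := by rw [abs_mul, abs_of_pos hη]
        rw [e1, e2, abs_le]
        constructor
        · linarith [k'.1, k'.2, p1.1, p1.2, p3.1, p3.2]
        · linarith [k'.1, k'.2, p1.1, p1.2, p3.1, p3.2]
      rw [Real.norm_eq_abs]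
      exact le_of_mul_le_mul_left this hη
    · intro σ hσ
      refine (h.line1 (hmem (hb σ hσ)) ht).sub ?_
      have := ((hasDerivAt_id σ).mul_const (u1 y t (η • e))).const_add (u y t)
      refine this.congr_deriv ?_
      norm_num
    · intro σ hσ
      exact (h.line2 (hmem (hb σ hσ)) ht).sub_const _
    · intro σ hσ
      have b1 := (u2 (y + σ • (η • e)) t).le_opNorm₂ (η • e) (η • e)
      rw [hn e he, Real.norm_eq_abs] at b1
      have b2 := hκ _ (hb σ hσ)
      have b3 := norm_le_norm_add_norm_sub' (u2 (y + σ • (η • e)) t) (u2 y t)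
      refine b1.trans ?_
      have : ‖u2 (y + σ • (η • e)) t‖ ≤ ‖u2 y t‖ + κ := by linarith
      rw [mul_assoc, ← pow_two, mul_comm]
      gcongr
    · simp
    · simp

/-- weight -/
noncomputable def wd {n : ℕ} (ρ tb : ℝ) (x : EE n) (t : ℝ) : ℝ := min (ρ - ‖x‖) (√(t - tb))

lemma wd_facts {n : ℕ} {ρ tb : ℝ} {x : EE n} {t : ℝ} (h : 0 < wd ρ tb x t) :
    x ∈ ball (0 : EE n) ρ ∧ tb < t ∧ wd ρ tb x t ≤ ρ - ‖x‖ ∧ (wd ρ tb x t) ^ 2 ≤ t - tb := by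
  have h1 : 0 < ρ - ‖x‖ := lt_of_lt_of_le h (min_le_left _ _)
  have h2 : 0 < √(t - tb) := lt_of_lt_of_le h (min_le_right _ _)
  have h3 : 0 < t - tb := Real.sqrt_pos.mp h2
  refine ⟨by rw [mem_ball_zero_iff]; linarith, by linarith, min_le_left _ _, ?_⟩
  have h4 : wd ρ tb x t ≤ √(t - tb) := min_le_right _ _
  calc (wd ρ tb x t) ^ 2 ≤ (√(t - tb)) ^ 2 := by gcongr
    _ = t - tb := Real.sq_sqrt h3.le

lemma wd_half {n : ℕ} {ρ tb : ℝ} {x y : EE n} {t s : ℝ} (h : 0 < wd ρ tb x t)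
    (hy : ‖y - x‖ ≤ wd ρ tb x t / 4) (hs : t - (wd ρ tb x t / 16) ^ 2 ≤ s) :
    wd ρ tb x t / 2 ≤ wd ρ tb y s := by
  obtain ⟨h1, h2, h3, h4⟩ := wd_facts h
  set d := wd ρ tb x t
  refine le_min ?_ ?_
  · have := norm_le_norm_add_norm_sub' y x
    linarith
  · apply Real.le_sqrt_of_sq_le
    nlinarith

/-- weighted Hölder bound -/
def PH {n : ℕ} (α ρ tb T : ℝ) (u2 : EE n → ℝ → EE n →L[ℝ] EE n →L[ℝ] ℝ) (H : ℝ) : Prop :=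
  ∀ x t y, 0 < wd ρ tb x t → t ≤ T → ‖y - x‖ ≤ wd ρ tb x t / 4 →
    wd ρ tb x t ^ 3 * ‖u2 y t - u2 x t‖ ≤ H * ‖y - x‖ ^ α

/-- local form of the weighted bound -/
lemma PH.loc {n : ℕ} {α ρ tb T H d : ℝ} {u2 : EE n → ℝ → EE n →L[ℝ] EE n →L[ℝ] ℝ}
    (h : PH α ρ tb T u2 H) (hH : 0 ≤ H) {y z : EE n} {s : ℝ} (hd : 0 < d) (hy : d / 2 ≤ wd ρ tb y s)
    (hs : s ≤ T) (hz : ‖z - y‖ ≤ d / 8) :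
    ‖u2 z s - u2 y s‖ ≤ 8 * H / d ^ 3 * ‖z - y‖ ^ α := by
  have h1 := h y s z (by linarith) hs (by linarith)
  have h2 : (d / 2) ^ 3 ≤ wd ρ tb y s ^ 3 := by gcongr
  have h3 : (d / 2) ^ 3 * ‖u2 z s - u2 y s‖ ≤ H * ‖z - y‖ ^ α :=
    (mul_le_mul_of_nonneg_right h2 (norm_nonneg (u2 z s - u2 y s))).trans h1
  have hd3 : 0 < d ^ 3 := by positivity
  rw [div_mul_eq_mul_div, le_div_iff₀ hd3]
  rw [div_pow] at h3
  linarith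

/-- the differential operator -/
noncomputable def LL {n : ℕ} (a : Fin n → Fin n → EE n → ℝ → ℝ) (b : Fin n → EE n → ℝ → ℝ)
    (c u : EE n → ℝ → ℝ) (u1 : EE n → ℝ → EE n →L[ℝ] ℝ)
    (u2 : EE n → ℝ → EE n →L[ℝ] EE n →L[ℝ] ℝ) (ut : EE n → ℝ → ℝ) (y : EE n) (t : ℝ) : ℝ :=
  ut y t - con (fun i j => a i j y t) (u2 y t)
    - (∑ i, b i y t * u1 y t (EuclideanSpace.single i (1 : ℝ))) - c y t * u y t

/-- hypotheses of the a priori estimate -/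
structure Prob {n : ℕ} (α lam Λ ρ tb T M Kf : ℝ)
    (a : Fin n → Fin n → EE n → ℝ → ℝ) (b : Fin n → EE n → ℝ → ℝ) (c : EE n → ℝ → ℝ)
    (u : EE n → ℝ → ℝ)
    (u1 : EE n → ℝ → EE n →L[ℝ] ℝ) (u2 : EE n → ℝ → EE n →L[ℝ] EE n →L[ℝ] ℝ)
    (ut : EE n → ℝ → ℝ) : Prop where
  reg : Reg (ball 0 ρ) (Icc tb T) u u1 u2 ut
  ell : ∀ t ∈ Icc tb T, ∀ y ∈ ball (0 : EE n) ρ, ∀ ξ : Fin n → ℝ,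
      lam * (∑ i, ξ i ^ 2) ≤ ∑ i, ∑ j, a i j y t * ξ i * ξ j
  bdd : ∀ t ∈ Icc tb T, ∀ y ∈ ball (0 : EE n) ρ, ∑ i, ∑ j, |a i j y t| ≤ Λ
  hol : ∀ t ∈ Icc tb T, ∀ y ∈ ball (0 : EE n) ρ, ∀ y' ∈ ball (0 : EE n) ρ,
    ∑ i, ∑ j, |a i j y t - a i j y' t| ≤ Λ * ‖y - y'‖ ^ α
  bbdd : ∀ t ∈ Icc tb T, ∀ y ∈ ball (0 : EE n) ρ, ∑ i, |b i y t| ≤ Λ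
  bhol : ∀ t ∈ Icc tb T, ∀ y ∈ ball (0 : EE n) ρ, ∀ y' ∈ ball (0 : EE n) ρ,
    ∑ i, |b i y t - b i y' t| ≤ Λ * ‖y - y'‖ ^ α
  cbdd : ∀ t ∈ Icc tb T, ∀ y ∈ ball (0 : EE n) ρ, |c y t| ≤ Λ
  chol : ∀ t ∈ Icc tb T, ∀ y ∈ ball (0 : EE n) ρ, ∀ y' ∈ ball (0 : EE n) ρ,
    |c y t - c y' t| ≤ Λ * ‖y - y'‖ ^ α
  hu : ∀ t ∈ Icc tb T, ∀ y ∈ ball (0 : EE n) ρ, |u y t| ≤ M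
  hf : ∀ t ∈ Icc tb T, ∀ y ∈ ball (0 : EE n) ρ, ∀ y' ∈ ball (0 : EE n) ρ,
    |LL a b c u u1 u2 ut y t - LL a b c u u1 u2 ut y' t| ≤ Kf * ‖y - y'‖ ^ α

lemma abs_vec_le {n : ℕ} (b : Fin n → ℝ) (l : EE n →L[ℝ] ℝ) :
    |∑ i, b i * l (EuclideanSpace.single i (1 : ℝ))| ≤ (∑ i, |b i|) * ‖l‖ := by
  refine (Finset.abs_sum_le_sum_abs _ _).trans ?_
  rw [Finset.sum_mul]
  refine Finset.sum_le_sum fun i _ => ?_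
  rw [abs_mul]
  refine mul_le_mul_of_nonneg_left ?_ (abs_nonneg _)
  have := l.le_opNorm (EuclideanSpace.single i (1 : ℝ))
  simpa using this

/-- lower order terms are absorbed into the right-hand side -/
lemma lower_order {n : ℕ} {α Λ M S Kf : ℝ} (hα : α ∈ Ioo (0 : ℝ) 1) (hΛ : 0 < Λ)
    {x0 : EE n} {D : ℝ} {I : Set ℝ} {a : Fin n → Fin n → EE n → ℝ → ℝ}
    {b : Fin n → EE n → ℝ → ℝ} {c : EE n → ℝ → ℝ} {u u1 u2 ut}
    (hreg : Reg (ball x0 D) I u u1 u2 ut) {t : ℝ} (ht : t ∈ I)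
    (bbdd : ∀ y ∈ ball x0 D, ∑ i, |b i y t| ≤ Λ)
    (bhol : ∀ y ∈ ball x0 D, ∀ y' ∈ ball x0 D, ∑ i, |b i y t - b i y' t| ≤ Λ * ‖y - y'‖ ^ α)
    (cbdd : ∀ y ∈ ball x0 D, |c y t| ≤ Λ)
    (chol : ∀ y ∈ ball x0 D, ∀ y' ∈ ball x0 D, |c y t - c y' t| ≤ Λ * ‖y - y'‖ ^ α)
    (hu : ∀ y ∈ ball x0 D, |u y t| ≤ M) (hu1 : ∀ y ∈ ball x0 D, ‖u1 y t‖ ≤ S)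
    (hu2 : ∀ y ∈ ball x0 D, ‖u2 y t‖ ≤ S)
    (hf : ∀ y ∈ ball x0 D, ∀ y' ∈ ball x0 D,
      |LL a b c u u1 u2 ut y t - LL a b c u u1 u2 ut y' t| ≤ Kf * ‖y - y'‖ ^ α)
    {y y' : EE n} (hy : y ∈ ball x0 D) (hy' : y' ∈ ball x0 D) (hyy : ‖y - y'‖ ≤ 1) :
    |(ut y t - con (fun i j => a i j y t) (u2 y t))
      - (ut y' t - con (fun i j => a i j y' t) (u2 y' t))|
      ≤ (Kf + Λ * M + 3 * Λ * S) * ‖y - y'‖ ^ α := by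
  have hr : ‖y - y'‖ ≤ ‖y - y'‖ ^ α := by
    have := Real.rpow_le_rpow_of_exponent_ge_of_imp (norm_nonneg (y - y')) hyy hα.2.le
      (fun _ h => absurd h one_ne_zero)
    rwa [Real.rpow_one] at this
  set R := ‖y - y'‖ ^ α with hR
  have hR0 : 0 ≤ R := by positivity
  have hS0 : 0 ≤ S := (norm_nonneg _).trans (hu1 y hy)
  have mv1 : ‖u1 y t - u1 y' t‖ ≤ S * R :=
    ((convex_ball x0 D).norm_image_sub_le_of_norm_hasFDerivWithin_le
      (fun z hz => (hreg.d2 z hz t ht).hasFDerivWithinAt) (fun z hz => hu2 z hz) hy' hy).trans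
      (mul_le_mul_of_nonneg_left hr hS0)
  have mv0 : |u y t - u y' t| ≤ S * R :=
    ((convex_ball x0 D).norm_image_sub_le_of_norm_hasFDerivWithin_le
      (fun z hz => (hreg.d1 z hz t ht).hasFDerivWithinAt) (fun z hz => hu1 z hz) hy' hy).trans
      (mul_le_mul_of_nonneg_left hr hS0)
  have e1 : (ut y t - con (fun i j => a i j y t) (u2 y t))
      - (ut y' t - con (fun i j => a i j y' t) (u2 y' t))
      = (LL a b c u u1 u2 ut y t - LL a b c u u1 u2 ut y' t)
        + (∑ i, b i y t * (u1 y t - u1 y' t) (EuclideanSpace.single i (1 : ℝ)))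
        + (∑ i, (b i y t - b i y' t) * u1 y' t (EuclideanSpace.single i (1 : ℝ)))
        + c y t * (u y t - u y' t) + (c y t - c y' t) * u y' t := by
    simp only [LL, _root_.sub_apply, mul_sub, sub_mul, Finset.sum_sub_distrib]
    ring
  have f1 := hf y hy y' hy'
  have f2 : |∑ i, b i y t * (u1 y t - u1 y' t) (EuclideanSpace.single i (1 : ℝ))|
      ≤ Λ * (S * R) :=
    (abs_vec_le (fun i => b i y t) _).trans
      (mul_le_mul (bbdd y hy) mv1 (norm_nonneg (u1 y t - u1 y' t)) hΛ.le)
  have f3 : |∑ i, (b i y t - b i y' t) * u1 y' t (EuclideanSpace.single i (1 : ℝ))|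
      ≤ (Λ * R) * S :=
    (abs_vec_le (fun i => b i y t - b i y' t) _).trans
      (mul_le_mul (bhol y hy y' hy') (hu1 y' hy') (norm_nonneg (u1 y' t)) (by positivity))
  have f4 : |c y t * (u y t - u y' t)| ≤ Λ * (S * R) := by
    rw [abs_mul]
    exact mul_le_mul (cbdd y hy) mv0 (abs_nonneg _) hΛ.le
  have f5 : |(c y t - c y' t) * u y' t| ≤ (Λ * R) * M := by
    rw [abs_mul]
    exact mul_le_mul (chol y hy y' hy') (hu y' hy') (abs_nonneg _) (by positivity)
  rw [e1]
  have f1 := abs_le.mp f1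
  have f2 := abs_le.mp f2
  have f3 := abs_le.mp f3
  have f4 := abs_le.mp f4
  have f5 := abs_le.mp f5
  rw [abs_le]
  constructor
  · linarith [f1.1, f2.1, f3.1, f4.1, f5.1]
  · linarith [f1.2, f2.2, f3.2, f4.2, f5.2]

lemma small_pow {α ε s0 : ℝ} (hα : 0 < α) (hε : 0 < ε) (hs0 : 0 < s0) :
    ∃ s : ℝ, 0 < s ∧ s ≤ s0 ∧ s ^ α ≤ ε := by
  refine ⟨min s0 (ε ^ α⁻¹), by positivity, min_le_left _ _, ?_⟩
  calc (min s0 (ε ^ α⁻¹)) ^ α ≤ (ε ^ α⁻¹) ^ α :=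
        Real.rpow_le_rpow (by positivity) (min_le_right _ _) hα.le
    _ = ε := Real.rpow_inv_rpow hε.le hα.ne'


/-- sup bounds for derivatives from the weighted Hölder bound -/
lemma Prob.sup {n : ℕ} {α lam Λ ρ tb T M Kf H d η0 : ℝ} {a b c u u1 u2 ut}
    (hP : Prob (n := n) α lam Λ ρ tb T M Kf a b c u u1 u2 ut) (hα : α ∈ Ioo (0 : ℝ) 1) (hM : 0 ≤ M)
    (hH : 0 ≤ H) (h : PH α ρ tb T u2 H) (hd : 0 < d) (hd2 : d ≤ 2) (hη0 : 0 < η0) (hη : η0 ≤ 1 / 8)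
    {y : EE n} {s : ℝ} (hy : d / 2 ≤ wd ρ tb y s) (hs : s ≤ T) :
    ‖u2 y s‖ ≤ 6 * M / (η0 * d) ^ 2 + 3 * (8 * H / d ^ 3 * (η0 * d) ^ α) ∧
    ‖u1 y s‖ ≤ 6 * M / (η0 * d) ^ 2 + 3 * (8 * H / d ^ 3 * (η0 * d) ^ α) := by
  obtain ⟨g1, g2, g3, g4⟩ := wd_facts (lt_of_lt_of_le (half_pos hd) hy)
  set η := η0 * d with hηd
  have hη1 : η ≤ d / 8 := by nlinarith
  have hηp : 0 < η := by positivity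
  set κ := 8 * H / d ^ 3 * η ^ α with hκ
  have hκ0 : 0 ≤ κ := by positivity
  have hcb : closedBall y η ⊆ ball 0 ρ := by
    intro z hz
    rw [mem_closedBall, dist_eq_norm] at hz
    rw [mem_ball_zero_iff]
    have := norm_le_norm_add_norm_sub' z y
    linarith
  have hst : s ∈ Icc tb T := ⟨g2.le, hs⟩
  obtain ⟨i1, i2⟩ := interp hP.reg isOpen_ball (y := y) (t := s) (η := η) (κ := κ) (M := M) hst hηp
    hcb (fun z hz => hP.hu s hst z hz) (fun z hz => by
      rw [mem_closedBall, dist_eq_norm] at hz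
      refine (h.loc hH hd hy hs (hz.trans hη1)).trans ?_
      rw [hκ]
      have := Real.rpow_le_rpow (norm_nonneg (z - y)) hz hα.1.le
      gcongr)
  have hMη : 0 ≤ M / η ^ 2 := by positivity
  have hM2 : M / η ≤ M / η ^ 2 := by
    apply div_le_div_of_nonneg_left hM (by positivity)
    nlinarith
  have r1 : 4 * M / η ^ 2 = 4 * (M / η ^ 2) := by ring
  have r2 : 6 * M / η ^ 2 = 6 * (M / η ^ 2) := by ring
  have r3 : 2 * M / η = 2 * (M / η) := by ring
  have hU : 0 ≤ ‖u2 y s‖ + κ := add_nonneg (norm_nonneg (u2 y s)) hκ0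
  rw [r1] at i1
  rw [r3] at i2
  rw [r2]
  constructor
  · linarith
  · have : η * (‖u2 y s‖ + κ) ≤ ‖u2 y s‖ + κ := by nlinarith
    linarith

set_option maxHeartbeats 1000000 in
lemma apriori_step {n : ℕ} {α lam Λ : ℝ} (hα : α ∈ Ioo (0 : ℝ) 1) (hlam : 0 < lam) (hΛ : 0 < Λ) :
    ∃ C : ℝ, 0 < C ∧ ∀ (ρ tb T M Kf : ℝ) (a b c u u1 u2 ut), ρ ≤ 2 → 0 ≤ M → 0 ≤ Kf →
      Prob (n := n) α lam Λ ρ tb T M Kf a b c u u1 u2 ut →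
      ∀ H : ℝ, 0 < H → PH α ρ tb T u2 H → PH α ρ tb T u2 (1 / 2 * H + C * (M + Kf)) := by
  obtain ⟨C2, hC2, core⟩ := core_osc (n := n) hα hlam hΛ
  obtain ⟨N, hN1, hNs⟩ : ∃ N : ℝ, 1 ≤ N ∧ N ^ α / N ≤ 1 / (64 * C2) := by
    obtain ⟨s, h1, h2, h3⟩ := small_pow (α := 1 - α) (ε := 1 / (64 * C2)) (s0 := 1)
      (by linarith [hα.2]) (by positivity) one_pos
    refine ⟨s⁻¹, (one_le_inv₀ h1).mpr h2, ?_⟩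
    refine le_of_eq_of_le ?_ h3
    rw [div_inv_eq_mul, Real.inv_rpow h1.le, Real.rpow_sub h1, Real.rpow_one]
    field_simp
  have hN0 : 0 < N := by linarith
  obtain ⟨s, hs0, hs1, hs2⟩ := small_pow (α := α) (ε := 1 / (64 * C2 * N)) (s0 := 1 / 64)
      hα.1 (by positivity) (by norm_num)
  set κ := s / (2 * N) with hκd
  have hκ0 : 0 < κ := by positivity
  have hκα : 0 < κ ^ α := by positivity
  obtain ⟨η0, hη0, hη8, hηs⟩ := small_pow (α := α)
    (ε := min (1 / (384 * (C2 * N * (1 + 3 * Λ)))) (κ ^ α / 192)) (s0 := 1 / 8)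
      hα.1 (by positivity) (by norm_num)
  have hηa : η0 ^ α ≤ 1 / (384 * (C2 * N * (1 + 3 * Λ))) := hηs.trans (min_le_left _ _)
  have hηb : η0 ^ α ≤ κ ^ α / 192 := hηs.trans (min_le_right _ _)
  set CA := C2 * N * (8 + 8 * Λ + (1 + 3 * Λ) * (12 / η0 ^ 2)) with hCA
  set CB := 24 / η0 ^ 2 / κ ^ α with hCB
  have hCA0 : 0 < CA := by positivity
  have hCB0 : 0 < CB := by positivity
  refine ⟨CA + CB, by positivity, ?_⟩
  intro ρ tb T M Kf a b c u u1 u2 ut hρ hM hKf hP H hH hPH x t y hd htT hyx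
  obtain ⟨g1, g2, g3, g4⟩ := wd_facts hd
  set d := wd ρ tb x t with hddef
  have hd2 : d ≤ 2 := by linarith [norm_nonneg x]
  set τ := ‖y - x‖ with hτ
  have hτα : 0 ≤ τ ^ α := by positivity
  have hdα : d ^ α ≤ 2 := by
    have h1 := rpow_mul_le (x := d / 2) (c := 2) (by positivity) (by norm_num) hα
    rw [show 2 * (d / 2) = d by ring] at h1
    have h2 : (d / 2) ^ α ≤ 1 := Real.rpow_le_one (by positivity) (by linarith) hα.1.le
    linarith
  have hdd : d ≤ 2 * d ^ α := by
    have h2 : (d / 2) ≤ (d / 2) ^ α := by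
      have := Real.rpow_le_rpow_of_exponent_ge (x := d / 2) (by positivity) (by linarith) hα.2.le
      rwa [Real.rpow_one] at this
    have h3 : (d / 2) ^ α ≤ d ^ α := Real.rpow_le_rpow (by positivity) (by linarith) hα.1.le
    linarith
  set S := 6 * M / (η0 * d) ^ 2 + 3 * (8 * H / d ^ 3 * (η0 * d) ^ α) with hS
  have hS0 : 0 ≤ S := by positivity
  have hd3 : 0 < d ^ 3 := by positivity
  have hQ : d ^ 3 * S = 6 * M * d / η0 ^ 2 + 24 * H * η0 ^ α * d ^ α := by
    rw [hS, Real.mul_rpow hη0.le hd.le]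
    field_simp
    ring
  have hsup : ∀ z s', d / 2 ≤ wd ρ tb z s' → s' ≤ T → ‖u2 z s'‖ ≤ S ∧ ‖u1 z s'‖ ≤ S :=
    fun z s' h1 h2 => hP.sup hα hM hH.le hPH hd hd2 hη0 hη8 h1 h2
  have hMK : 0 ≤ M + Kf := by positivity
  rcases eq_or_lt_of_le (norm_nonneg (y - x)) with h0 | hpos
  · have : y = x := by rw [← sub_eq_zero]; exact norm_eq_zero.mp h0.symm
    have hz : ‖u2 y t - u2 x t‖ = 0 := by
      have hz0 : u2 y t = u2 x t := by rw [this]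
      exact norm_eq_zero.mpr (sub_eq_zero.mpr hz0)
    rw [hz, mul_zero]
    positivity
  rw [← hτ] at hpos
  rcases le_total τ (κ * d) with hcase | hcase
  · -- small distances
    set D := d / 16 with hD
    have hD0 : 0 < D := by positivity
    have hcyl : ∀ s' ∈ Icc (t - D ^ 2) t, ∀ z ∈ ball x D, d / 2 ≤ wd ρ tb z s' := by
      intro s' hs' z hz
      rw [mem_ball, dist_eq_norm] at hz
      exact wd_half hd (by rw [← hddef]; linarith) hs'.1
    have hI : Icc (t - D ^ 2) t ⊆ Icc tb T := by
      intro s' hs'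
      exact ⟨by rw [hD] at hs'; nlinarith [hs'.1], hs'.2.trans htT⟩
    have hB : ball x D ⊆ ball 0 ρ := by
      intro z hz
      rw [mem_ball, dist_eq_norm] at hz
      rw [mem_ball_zero_iff]
      have := norm_le_norm_add_norm_sub' z x
      linarith
    have hzz : ∀ z ∈ ball x D, ∀ z' ∈ ball x D, ‖z - z'‖ ≤ d / 8 := by
      intro z hz z' hz'
      rw [mem_ball] at hz hz'
      rw [← dist_eq_norm]
      linarith [dist_triangle_right z z' x]
    have hreg : Reg (ball x D) (Icc (t - D ^ 2) t) u u1 u2 ut := hP.reg.mono hB hI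
    have hLoc : Loc α lam Λ x t D (8 * H / d ^ 3) S (Kf + Λ * M + 3 * Λ * S) a u u1 u2 ut := by
      refine ⟨hreg, fun t' ht' z hz => hP.ell t' (hI ht') z (hB hz),
        fun t' ht' z hz => hP.bdd t' (hI ht') z (hB hz),
        fun t' ht' z hz z' hz' => hP.hol t' (hI ht') z (hB hz) z' (hB hz'), ?_, ?_, ?_⟩
      · intro t' ht' z hz z' hz'
        exact hPH.loc hH.le hd (hcyl t' ht' z' hz') (hI ht').2 (hzz z hz z' hz')
      · intro t' ht' z hz
        exact (hsup z t' (hcyl t' ht' z hz) (hI ht').2).1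
      · intro t' ht' z hz z' hz'
        refine lower_order hα hΛ hreg ht' (b := b) (c := c)
          (fun z hz => hP.bbdd t' (hI ht') z (hB hz))
          (fun z hz z' hz' => hP.bhol t' (hI ht') z (hB hz) z' (hB hz'))
          (fun z hz => hP.cbdd t' (hI ht') z (hB hz))
          (fun z hz z' hz' => hP.chol t' (hI ht') z (hB hz) z' (hB hz'))
          (fun z hz => hP.hu t' (hI ht') z (hB hz))
          (fun z hz => (hsup z t' (hcyl t' ht' z hz) (hI ht').2).2)
          (fun z hz => (hsup z t' (hcyl t' ht' z hz) (hI ht').2).1)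
          (fun z hz z' hz' => hP.hf t' (hI ht') z (hB hz) z' (hB hz')) hz hz' ?_
        linarith [hzz z hz z' hz']
    have hNτ : N * τ ≤ s * d / 2 := by
      have : N * τ ≤ N * (κ * d) := by gcongr
      refine this.trans (le_of_eq ?_)
      rw [hκd]; field_simp
    have key := core x t D (8 * H / d ^ 3) S (Kf + Λ * M + 3 * Λ * S) a u u1 u2 ut (by positivity)
      hS0 (by positivity) hLoc N τ hN1 hpos (by rw [hD]; nlinarith) (y - x) hτ.symm
    rw [add_sub_cancel] at key
    have hNτα : (N * τ) ^ α ≤ s ^ α :=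
      Real.rpow_le_rpow (by positivity) (hNτ.trans (by nlinarith)) hα.1.le
    have key2 := mul_le_mul_of_nonneg_left key hd3.le
    refine key2.trans ?_
    rw [← mul_assoc]
    refine mul_le_mul_of_nonneg_right ?_ hτα
    have e1 : d ^ 3 * (C2 * (N ^ α / N * (8 * H / d ^ 3) + N * (Kf + Λ * M + 3 * Λ * S + S
        + (N * τ) ^ α * (8 * H / d ^ 3))))
        = 8 * H * C2 * (N ^ α / N) + C2 * N * (d ^ 3 * Kf + d ^ 3 * (Λ * M)
          + (1 + 3 * Λ) * (d ^ 3 * S)) + 8 * H * (C2 * N) * (N * τ) ^ α := by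
      field_simp
      ring
    rw [e1, hQ]
    have k1 : 8 * H * C2 * (N ^ α / N) ≤ 8 * H * C2 * (1 / (64 * C2)) := by gcongr
    have k1' : 8 * H * C2 * (1 / (64 * C2)) = H / 8 := by field_simp; ring
    have k2 : 8 * H * (C2 * N) * (N * τ) ^ α ≤ 8 * H * (C2 * N) * (1 / (64 * C2 * N)) := by
      have := hNτα.trans hs2
      gcongr
    have k2' : 8 * H * (C2 * N) * (1 / (64 * C2 * N)) = H / 8 := by field_simp; ring
    have hd8 : d ^ 3 ≤ 8 := by
      calc d ^ 3 ≤ 2 ^ 3 := by gcongr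
        _ = 8 := by norm_num
    have k3 : C2 * N * (d ^ 3 * Kf + d ^ 3 * (Λ * M)
          + (1 + 3 * Λ) * (6 * M * d / η0 ^ 2 + 24 * H * η0 ^ α * d ^ α))
        ≤ C2 * N * (8 * Kf + 8 * (Λ * M)
          + (1 + 3 * Λ) * (6 * M * 2 / η0 ^ 2
            + 24 * H * (1 / (384 * (C2 * N * (1 + 3 * Λ)))) * 2)) := by
      gcongr
    have k3' : C2 * N * (8 * Kf + 8 * (Λ * M)
          + (1 + 3 * Λ) * (6 * M * 2 / η0 ^ 2
            + 24 * H * (1 / (384 * (C2 * N * (1 + 3 * Λ)))) * 2))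
        = C2 * N * (8 * Kf + 8 * (Λ * M) + (1 + 3 * Λ) * (12 / η0 ^ 2) * M) + H / 8 := by
      field_simp
      ring
    have k4 : C2 * N * (8 * Kf + 8 * (Λ * M) + (1 + 3 * Λ) * (12 / η0 ^ 2) * M)
        ≤ CA * (M + Kf) := by
      rw [hCA, mul_assoc (C2 * N)]
      refine mul_le_mul_of_nonneg_left ?_ (by positivity)
      have w1 : 0 ≤ (1 + 3 * Λ) * (12 / η0 ^ 2) * Kf := by positivity
      have w2 : 0 ≤ Λ * Kf := by positivity
      linarith
    have k5 : 0 ≤ CB * (M + Kf) := by positivity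
    rw [add_mul]
    linarith
  · -- large distances
    have h1 := (hsup y t (wd_half hd hyx (by nlinarith [sq_nonneg (wd ρ tb x t / 16)])) htT).1
    have h2 := (hsup x t (by linarith) htT).1
    have h3 := norm_sub_le (u2 y t) (u2 x t)
    have h4 : d ^ 3 * ‖u2 y t - u2 x t‖ ≤ d ^ 3 * (2 * S) :=
      mul_le_mul_of_nonneg_left (by linarith) hd3.le
    refine h4.trans ?_
    have e1 : d ^ 3 * (2 * S) = 2 * (d ^ 3 * S) := by ring
    rw [e1, hQ]
    have hdτ : d ^ α ≤ τ ^ α / κ ^ α := by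
      rw [le_div_iff₀ hκα, ← Real.mul_rpow hd.le hκ0.le, mul_comm]
      exact Real.rpow_le_rpow (by positivity) hcase hα.1.le
    have k1 : 2 * (6 * M * d / η0 ^ 2 + 24 * H * η0 ^ α * d ^ α)
        ≤ 2 * (6 * M * (2 * d ^ α) / η0 ^ 2 + 24 * H * (κ ^ α / 192) * d ^ α) := by gcongr
    have k2 : 2 * (6 * M * (2 * d ^ α) / η0 ^ 2 + 24 * H * (κ ^ α / 192) * d ^ α)
        = (24 * M / η0 ^ 2 + H * κ ^ α / 4) * d ^ α := by ring
    have k3 : (24 * M / η0 ^ 2 + H * κ ^ α / 4) * d ^ α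
        ≤ (24 * M / η0 ^ 2 + H * κ ^ α / 4) * (τ ^ α / κ ^ α) := by gcongr
    have k4 : (24 * M / η0 ^ 2 + H * κ ^ α / 4) * (τ ^ α / κ ^ α)
        = (CB * M + H / 4) * τ ^ α := by
      rw [hCB]; field_simp
    have k5 : (CB * M + H / 4) * τ ^ α ≤ (1 / 2 * H + (CA + CB) * (M + Kf)) * τ ^ α := by
      refine mul_le_mul_of_nonneg_right ?_ hτα
      have w1 : 0 ≤ CA * (M + Kf) := by positivity
      have w2 : 0 ≤ CB * Kf := by positivity
      linarith
    linarith

lemma apriori {n : ℕ} {α lam Λ : ℝ} (hα : α ∈ Ioo (0 : ℝ) 1) (hlam : 0 < lam) (hΛ : 0 < Λ) :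
    ∃ C : ℝ, 0 < C ∧ ∀ (ρ tb T M Kf : ℝ) (a b c u u1 u2 ut), ρ ≤ 2 → 0 ≤ M → 0 ≤ Kf →
      Prob (n := n) α lam Λ ρ tb T M Kf a b c u u1 u2 ut →
      (∃ H : ℝ, 0 < H ∧ PH α ρ tb T u2 H) → PH α ρ tb T u2 (C * (M + Kf)) := by
  obtain ⟨C, hC, step⟩ := apriori_step (n := n) hα hlam hΛ
  refine ⟨2 * C, by positivity, ?_⟩
  intro ρ tb T M Kf a b c u u1 u2 ut hρ hM hKf hP ⟨H0, hH0, hPH0⟩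
  have key := contraction_const
    (ι := {p : EE n × ℝ × EE n // 0 < wd ρ tb p.1 p.2.1 ∧ p.2.1 ≤ T ∧
      ‖p.2.2 - p.1‖ ≤ wd ρ tb p.1 p.2.1 / 4})
    (fun p => wd ρ tb p.1.1 p.1.2.1 ^ 3 * ‖u2 p.1.2.2 p.1.2.1 - u2 p.1.1 p.1.2.1‖)
    (fun p => ‖p.1.2.2 - p.1.1‖ ^ α) (1 / 2) (C * (M + Kf)) (by norm_num) (by norm_num)
    (by positivity) ?_ ⟨H0, hH0, ?_⟩ ?_
  · intro x t y h1 h2 h3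
    have := key ⟨(x, t, y), h1, h2, h3⟩
    simp only at this
    refine this.trans (le_of_eq ?_)
    ring
  · intro B hB hall ⟨⟨x, t, y⟩, h1, h2, h3⟩
    exact step ρ tb T M Kf a b c u u1 u2 ut hρ hM hKf hP B hB
      (fun x t y h1 h2 h3 => hall ⟨(x, t, y), h1, h2, h3⟩) x t y h1 h2 h3
  · intro ⟨⟨x, t, y⟩, h1, h2, h3⟩
    exact hPH0 x t y h1 h2 h3
  · intro p
    positivity


/-- hypotheses for the qualitative regularity result -/
structure Rough {n : ℕ} (α lam Λ ρ tb T S2 KF : ℝ)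
    (a : Fin n → Fin n → EE n → ℝ → ℝ) (u : EE n → ℝ → ℝ)
    (u1 : EE n → ℝ → EE n →L[ℝ] ℝ) (u2 : EE n → ℝ → EE n →L[ℝ] EE n →L[ℝ] ℝ)
    (ut : EE n → ℝ → ℝ) : Prop where
  reg : Reg (ball 0 ρ) (Icc tb T) u u1 u2 ut
  cont2 : ∀ t ∈ Icc tb T, ContinuousOn (fun y => u2 y t) (ball 0 ρ)
  ell : ∀ t ∈ Icc tb T, ∀ y ∈ ball (0 : EE n) ρ, ∀ ξ : Fin n → ℝ,
      lam * (∑ i, ξ i ^ 2) ≤ ∑ i, ∑ j, a i j y t * ξ i * ξ j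
  bdd : ∀ t ∈ Icc tb T, ∀ y ∈ ball (0 : EE n) ρ, ∑ i, ∑ j, |a i j y t| ≤ Λ
  hol : ∀ t ∈ Icc tb T, ∀ y ∈ ball (0 : EE n) ρ, ∀ y' ∈ ball (0 : EE n) ρ,
    ∑ i, ∑ j, |a i j y t - a i j y' t| ≤ Λ * ‖y - y'‖ ^ α
  hS : ∀ t ∈ Icc tb T, ∀ y ∈ ball (0 : EE n) ρ, ‖u2 y t‖ ≤ S2
  hF : ∀ t ∈ Icc tb T, ∀ y ∈ ball (0 : EE n) ρ, ∀ y' ∈ ball (0 : EE n) ρ,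
    |(ut y t - con (fun i j => a i j y t) (u2 y t))
      - (ut y' t - con (fun i j => a i j y' t) (u2 y' t))| ≤ KF * ‖y - y'‖ ^ α

lemma Rough.frozen {n : ℕ} {α lam Λ ρ tb T S2 KF : ℝ} {a u u1 u2 ut}
    (hR : Rough (n := n) α lam Λ ρ tb T S2 KF a u u1 u2 ut) (hα : α ∈ Ioo (0 : ℝ) 1) (hΛ : 0 < Λ)
    (hS2 : 0 ≤ S2) (hKF : 0 ≤ KF) {p y y' : EE n} {t r : ℝ} (hr : 0 < r)
    (ht : t ∈ Icc tb T) (hp : p ∈ ball (0 : EE n) ρ) (hy : y ∈ ball (0 : EE n) ρ)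
    (hy' : y' ∈ ball (0 : EE n) ρ) (hyp : ‖y - p‖ ≤ 3 * r) (hyp' : ‖y' - p‖ ≤ 3 * r)
    (hyy : ‖y' - y‖ ≤ r) :
    |(ut y' t - con (fun i j => a i j p t) (u2 y' t))
      - (ut y t - con (fun i j => a i j p t) (u2 y t))| ≤ (KF + 6 * Λ * S2) * r ^ α := by
  have e1 : (ut y' t - con (fun i j => a i j p t) (u2 y' t))
      - (ut y t - con (fun i j => a i j p t) (u2 y t))
      = ((ut y' t - con (fun i j => a i j y' t) (u2 y' t))
      - (ut y t - con (fun i j => a i j y t) (u2 y t)))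
      + con (fun i j => a i j y' t - a i j p t) (u2 y' t)
      - con (fun i j => a i j y t - a i j p t) (u2 y t) := by
    rw [con_sub_left, con_sub_left]; ring
  rw [e1]
  have h3 : ∀ z : EE n, ‖z - p‖ ≤ 3 * r → ‖z - p‖ ^ α ≤ 3 * r ^ α := fun z hz =>
    (Real.rpow_le_rpow (norm_nonneg _) hz hα.1.le).trans (rpow_mul_le hr.le (by norm_num) hα)
  have hra : 0 ≤ r ^ α := by positivity
  have g : ∀ z ∈ ball (0 : EE n) ρ, ‖z - p‖ ≤ 3 * r →
      |con (fun i j => a i j z t - a i j p t) (u2 z t)| ≤ (Λ * (3 * r ^ α)) * S2 := by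
    intro z hz hzp
    refine (abs_con_le (fun i j => a i j z t - a i j p t) (u2 z t)).trans ?_
    exact mul_le_mul ((hR.hol t ht z hz p hp).trans (mul_le_mul_of_nonneg_left (h3 z hzp) hΛ.le))
      (hR.hS t ht z hz) (norm_nonneg (u2 z t)) (by positivity)
  have g1 := abs_le.mp (g y hy hyp)
  have g2 := abs_le.mp (g y' hy' hyp')
  have g3 := abs_le.mp ((hR.hF t ht y' hy' y hy).trans (mul_le_mul_of_nonneg_left
    (Real.rpow_le_rpow (norm_nonneg _) hyy hα.1.le) hKF))
  rw [abs_le]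
  constructor
  · linarith [g1.1, g1.2, g2.1, g2.2, g3.1, g3.2]
  · linarith [g1.1, g1.2, g2.1, g2.2, g3.1, g3.2]

lemma Rough.dd_bound {n : ℕ} {α lam Λ ρ tb T S2 KF : ℝ} {a u u1 u2 ut}
    (hR : Rough (n := n) α lam Λ ρ tb T S2 KF a u u1 u2 ut) {y k : EE n} {t : ℝ}
    (ht : t ∈ Icc tb T) (hy : ‖y‖ + ‖k‖ < ρ) : |dd k u y t| ≤ 5 * S2 * ‖k‖ ^ 2 := by
  have hmem : ∀ σ ∈ Icc (-1 : ℝ) 1, y + σ • k ∈ ball (0 : EE n) ρ := by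
    intro σ hσ
    have h1 : ‖σ • k‖ ≤ ‖k‖ := by
      rw [norm_smul, Real.norm_eq_abs]
      have := abs_le.mpr hσ
      nlinarith [norm_nonneg k]
    rw [mem_ball_zero_iff]
    linarith [norm_add_le y (σ • k)]
  have hy0 : y ∈ ball (0 : EE n) ρ := by
    rw [mem_ball_zero_iff]; linarith [norm_nonneg k]
  have h1 := abs_le.mp (dd_taylor hR.reg (κ := 2 * S2) ht hmem (fun σ hσ => by
    have a1 := hR.hS t ht _ (hmem σ hσ)
    have a2 := hR.hS t ht y hy0
    have a3 := norm_sub_le (u2 (y + σ • k) t) (u2 y t)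
    linarith))
  have h2 := (u2 y t).le_opNorm₂ k k
  have h3 : ‖u2 y t‖ * ‖k‖ * ‖k‖ ≤ S2 * ‖k‖ * ‖k‖ := by
    have := hR.hS t ht y hy0
    gcongr
  rw [Real.norm_eq_abs] at h2
  have h4 := abs_le.mp (h2.trans h3)
  rw [abs_le]
  constructor
  · linarith [h1.1, h4.1]
  · linarith [h1.2, h4.2]

set_option maxHeartbeats 1000000 in
lemma Rough.td {n : ℕ} {α lam Λ : ℝ} (hα : α ∈ Ioo (0 : ℝ) 1) (hlam : 0 < lam) (hΛ : 0 < Λ) :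
    ∃ C3 : ℝ, 0 < C3 ∧ ∀ (ρ tb T S2 KF : ℝ) (a u u1 u2 ut),
    Rough (n := n) α lam Λ ρ tb T S2 KF a u u1 u2 ut → 0 ≤ S2 → 0 ≤ KF →
    ∀ (t0 r W : ℝ) (k x y : EE n), 0 < ‖k‖ → ‖k‖ ≤ r → 0 < W → ‖x - y‖ ≤ 2 * ‖k‖ →
      ‖x‖ + 4 * r < ρ → tb ≤ t0 - r ^ 2 → t0 ≤ T →
      (∀ t ∈ Icc (t0 - r ^ 2) t0, ∀ z ∈ closedBall ((1 / 2 : ℝ) • (x + y)) (2 * r),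
        ∀ z' ∈ closedBall ((1 / 2 : ℝ) • (x + y)) (2 * r), dd k u z t - dd k u z' t ≤ W) →
      dd k u x t0 - dd k u y t0 ≤ C3 * (W * ‖k‖ / r + (KF + S2) * r ^ α * r * ‖k‖) := by
  refine ⟨2 * (1 + (1 + Λ) / lam) + 4 * (1 + 6 * Λ) / lam, by positivity, ?_⟩
  intro ρ tb T S2 KF a u u1 u2 ut hR hS2 hKF t0 r W k x y hσ hσr hW hxy hx htb htT hosc
  set σ := ‖k‖ with hk
  have hr0 : 0 < r := by linarith
  rcases eq_or_ne x y with rfl | hne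
  · rw [sub_self]; positivity
  have hd0 : 0 < ‖x - y‖ := norm_pos_iff.mpr (sub_ne_zero.mpr hne)
  set h := ‖x - y‖ / 2 with hh
  set e : EE n := ‖x - y‖⁻¹ • (x - y) with hedef
  have he : ‖e‖ = 1 := by
    rw [hedef, norm_smul, norm_inv, norm_norm, inv_mul_cancel₀ hd0.ne']
  set p : EE n := (1 / 2 : ℝ) • (x + y) with hpdef
  have hhe : h • e = (1 / 2 : ℝ) • (x - y) := by
    rw [hh, hedef, smul_smul]; congr 1; field_simp
  have hpy : p + h • e = x := by
    rw [hhe, hpdef, ← smul_add, show x + y + (x - y) = (2 : ℝ) • x by rw [two_smul]; abel,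
      smul_smul]
    norm_num
  have hpy' : p - h • e = y := by
    rw [hhe, hpdef, ← smul_sub, show x + y - (x - y) = (2 : ℝ) • y by rw [two_smul]; abel,
      smul_smul]
    norm_num
  have hpx : ‖p - x‖ ≤ r := by
    have h1 : p - x = -(h • e) := by rw [← hpy]; abel
    rw [h1, norm_neg, norm_smul, he, Real.norm_eq_abs, abs_of_pos (by positivity)]
    linarith
  have hcb : closedBall p (2 * r) ⊆ ball x (3 * r + (ρ - ‖x‖ - 4 * r)) := by
    intro z hz
    rw [mem_closedBall, dist_eq_norm] at hz
    rw [mem_ball, dist_eq_norm]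
    have := norm_add_le (z - p) (p - x)
    rw [sub_add_sub_cancel] at this
    linarith
  have hI : Icc (t0 - r ^ 2) t0 ⊆ Icc tb T := Icc_subset_Icc htb htT
  have hb : ∀ z ∈ ball x (3 * r + (ρ - ‖x‖ - 4 * r)), ‖z‖ + σ < ρ := by
    intro z hz
    rw [mem_ball, dist_eq_norm] at hz
    have := norm_le_norm_add_norm_sub' z x
    linarith
  have hball0 : ∀ z ∈ ball x (3 * r + (ρ - ‖x‖ - 4 * r)), z ∈ ball (0 : EE n) ρ := by
    intro z hz
    rw [mem_ball_zero_iff]; linarith [hb z hz]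
  have hballp : ∀ z ∈ ball x (3 * r + (ρ - ‖x‖ - 4 * r)), z + k ∈ ball (0 : EE n) ρ := by
    intro z hz
    rw [mem_ball_zero_iff]; linarith [hb z hz, norm_add_le z k]
  have hballm : ∀ z ∈ ball x (3 * r + (ρ - ‖x‖ - 4 * r)), z - k ∈ ball (0 : EE n) ρ := by
    intro z hz
    rw [mem_ball_zero_iff]; linarith [hb z hz, norm_sub_le z k]
  have hreg : Reg (ball x (3 * r + (ρ - ‖x‖ - 4 * r))) (Icc (t0 - r ^ 2) t0)
      (dd k u) (dd k u1) (dd k u2) (dd k ut) :=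
    (hR.reg.mono subset_rfl hI).dd k hball0 hballp hballm
  have hpD : p ∈ ball (0 : EE n) ρ := hball0 p (hcb (mem_closedBall_self (by positivity)))
  set Γ := 2 * ((KF + 6 * Λ * S2) * r ^ α) with hΓdef
  have hΓ : 0 ≤ Γ := by positivity
  set μ := W / r ^ 2 + (2 * Γ + W / r ^ 2 * (2 + 2 * Λ)) / (2 * lam) with hμdef
  have hWr : 0 < W / r ^ 2 := by positivity
  have key := grad_est (n := n) (lam := lam) (Λ := Λ) (r := r) (Γ := Γ) (W := W) (μ := μ) hlam hr0
    hW.le (p := p) (t0 := t0) isOpen_ball hcb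
    (A := fun t i j => a i j p t) (fun t ht => hR.ell t (hI ht) p hpD)
    (fun t ht => hR.bdd t (hI ht) p hpD) hreg hosc ?_ ?_ ?_ he (h := h)
    ⟨by positivity, by rw [hh]; linarith⟩
  · rw [hpy, hpy'] at key
    refine key.trans ?_
    have hhσ : h ≤ σ := by rw [hh]; linarith
    have hμ0 : 0 ≤ μ := by positivity
    have s1 : 2 * r * μ * h ≤ 2 * r * μ * σ := mul_le_mul_of_nonneg_left hhσ (by positivity)
    refine s1.trans ?_
    have e1 : 2 * r * μ * σ = 2 * (1 + (1 + Λ) / lam) * (W * σ / r)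
        + 4 / lam * (KF + 6 * Λ * S2) * (r ^ α * r * σ) := by
      rw [hμdef, hΓdef]
      field_simp
      ring
    rw [e1]
    have e2 : KF + 6 * Λ * S2 ≤ (1 + 6 * Λ) * (KF + S2) := by
      linarith [mul_nonneg hΛ.le hKF, mul_nonneg hΛ.le hS2]
    have e3 : 4 / lam * (KF + 6 * Λ * S2) * (r ^ α * r * σ)
        ≤ 4 / lam * ((1 + 6 * Λ) * (KF + S2)) * (r ^ α * r * σ) := by gcongr
    have e4 : 4 / lam * ((1 + 6 * Λ) * (KF + S2)) * (r ^ α * r * σ)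
      = 4 * (1 + 6 * Λ) / lam * ((KF + S2) * r ^ α * r * σ) := by ring
    rw [e4] at e3
    have g1 : 0 ≤ 2 * (1 + (1 + Λ) / lam) * ((KF + S2) * r ^ α * r * σ) := by positivity
    have g2 : 0 ≤ 4 * (1 + 6 * Λ) / lam * (W * σ / r) := by positivity
    rw [add_mul, mul_add, mul_add]
    linarith
  · intro t ht z hz
    rw [con_dd]
    have hz0 := hball0 z (hcb hz)
    have hzp := hballp z (hcb hz)
    have hzm := hballm z (hcb hz)
    have hzp' : ‖z - p‖ ≤ 2 * r := by rw [← dist_eq_norm]; exact hz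
    have f1 := hR.frozen hα hΛ hS2 hKF hr0 (hI ht) hpD hz0 hzp (by linarith) (by
      rw [show z + k - p = (z - p) + k by abel]
      linarith [norm_add_le (z - p) k]) (by rw [add_sub_cancel_left]; exact hσr)
    have f2 := hR.frozen hα hΛ hS2 hKF hr0 (hI ht) hpD hz0 hzm (by linarith) (by
      rw [show z - k - p = (z - p) - k by abel]
      linarith [norm_sub_le (z - p) k]) (by
        rw [show z - k - z = -k by abel, norm_neg]; exact hσr)
    have f1 := abs_le.mp f1
    have f2 := abs_le.mp f2
    rw [hΓdef]
    simp only [dd, smul_eq_mul]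
    rw [abs_le]
    constructor
    · linarith [f1.1, f2.1]
    · linarith [f1.2, f2.2]
  · have : W = W / r ^ 2 * r ^ 2 := by field_simp
    nth_rewrite 1 [this]
    refine mul_le_mul_of_nonneg_right ?_ (by positivity)
    rw [hμdef]
    have : 0 ≤ (2 * Γ + W / r ^ 2 * (2 + 2 * Λ)) / (2 * lam) := by positivity
    linarith
  · have : 2 * lam * μ = 2 * lam * (W / r ^ 2) + (2 * Γ + W / r ^ 2 * (2 + 2 * Λ)) := by
      rw [hμdef]; field_simp
    rw [this]
    linarith [mul_pos hlam hWr]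

/-- telescoping second differences over dyadic scales -/
lemma chain {n : ℕ} {α K R : ℝ} (hα : 0 < α) (hK : 0 ≤ K) (u : EE n → ℝ → ℝ) (t : ℝ) (z : EE n)
    {σ0 : ℝ}
    (h : ∀ k : EE n, σ0 ≤ ‖k‖ → ‖k‖ ≤ R → ∀ y, ‖y - z‖ ≤ 2 * ‖k‖ →
      |dd k u y t - dd k u z t| ≤ K * (‖k‖ ^ 2 * ‖k‖ ^ α)) (k : EE n) (hk : σ0 ≤ ‖k‖) (j : ℕ)
    (hj : 2 ^ j * ‖k‖ ≤ R) :
    |dd ((2 : ℝ) ^ j • k) u z t - 4 ^ j * dd k u z t|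
      ≤ 1 / 2 / (2 ^ α - 1) * K * ((2 ^ j * ‖k‖) ^ 2 * (2 ^ j * ‖k‖) ^ α) := by
  have h2α : 0 < (2 : ℝ) ^ α - 1 := by
    have := Real.one_lt_rpow (x := 2) (by norm_num) hα
    linarith
  induction j with
  | zero => simp; positivity
  | succ j ih =>
    have hjR : 2 ^ j * ‖k‖ ≤ R := by
      refine le_trans ?_ hj
      rw [pow_succ]
      have : 0 ≤ 2 ^ j * ‖k‖ := by positivity
      linarith
    have ih := abs_le.mp (ih hjR)
    set k' := (2 : ℝ) ^ j • k with hk'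
    have hn : ‖k'‖ = 2 ^ j * ‖k‖ := by
      rw [hk', norm_smul, Real.norm_eq_abs, abs_of_pos (by positivity)]
    have e0 : (2 : ℝ) ^ (j + 1) • k = (2 : ℝ) • k' := by
      rw [hk', smul_smul, pow_succ, mul_comm]
    have hkk : σ0 ≤ ‖k'‖ := by
      rw [hn]
      have : (1 : ℝ) ≤ 2 ^ j := one_le_pow₀ (by norm_num)
      nlinarith [norm_nonneg k]
    have d := dd_double u k' z t
    have h1 := abs_le.mp (h k' hkk (by rw [hn]; exact hjR) (z + k') (by
      rw [add_sub_cancel_left]; linarith [norm_nonneg k']))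
    have h2 := abs_le.mp (h k' hkk (by rw [hn]; exact hjR) (z - k') (by
      rw [show z - k' - z = -k' by abel, norm_neg]; linarith [norm_nonneg k']))
    rw [e0]
    rw [hn] at h1 h2
    set s := 2 ^ j * ‖k‖ with hs
    have hs0 : 0 ≤ s := by positivity
    have e1 : (2 : ℝ) ^ (j + 1) * ‖k‖ = 2 * s := by rw [hs, pow_succ]; ring
    rw [e1, Real.mul_rpow (by norm_num) hs0]
    set P := s ^ 2 * s ^ α with hP
    have e2 : 1 / 2 / (2 ^ α - 1) * K * ((2 * s) ^ 2 * (2 ^ α * s ^ α))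
        = 4 * (1 / 2 / (2 ^ α - 1) * K * P) + 2 * (K * P) := by
      rw [hP]; field_simp; ring
    rw [e2, pow_succ]
    rw [abs_le]
    constructor
    · linarith [ih.1, h1.1, h2.1]
    · linarith [ih.2, h1.2, h2.2]


/-- weighted bound for differences of second differences at scales at least `δ` -/
def D3 {n : ℕ} (α ρ tb T : ℝ) (u : EE n → ℝ → ℝ) (δ B : ℝ) : Prop :=
  ∀ (x : EE n) (t : ℝ) (k y : EE n), 0 < wd ρ tb x t → t ≤ T → δ ≤ ‖k‖ → ‖k‖ ≤ wd ρ tb x t / 16 →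
    ‖y - x‖ ≤ 2 * ‖k‖ →
    wd ρ tb x t ^ 3 * |dd k u y t - dd k u x t| ≤ B * (‖k‖ ^ 2 * ‖k‖ ^ α)

lemma D3.loc {n : ℕ} {α ρ tb T δ B d : ℝ} {u : EE n → ℝ → ℝ}
    (h : D3 α ρ tb T u δ B) {y z k : EE n} {s : ℝ} (hd : 0 < d) (hz : d / 2 ≤ wd ρ tb z s)
    (hs : s ≤ T) (hδ : δ ≤ ‖k‖) (hk : ‖k‖ ≤ d / 32) (hy : ‖y - z‖ ≤ 2 * ‖k‖) :
    |dd k u y s - dd k u z s| ≤ 8 * B / d ^ 3 * (‖k‖ ^ 2 * ‖k‖ ^ α) := by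
  have h1 := h z s k y (by linarith) hs hδ (by linarith) hy
  have h2 : (d / 2) ^ 3 ≤ wd ρ tb z s ^ 3 := by gcongr
  have h3 := (mul_le_mul_of_nonneg_right h2 (abs_nonneg (dd k u y s - dd k u z s))).trans h1
  have hd3 : 0 < d ^ 3 := by positivity
  rw [div_mul_eq_mul_div, le_div_iff₀ hd3]
  rw [div_pow] at h3
  linarith

lemma osc_chain {n : ℕ} {α K R : ℝ} (hα : 0 < α) (hK : 0 ≤ K) (u : EE n → ℝ → ℝ) (t : ℝ)
    (z z' : EE n) {σ0 : ℝ}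
    (h : ∀ k : EE n, σ0 ≤ ‖k‖ → ‖k‖ ≤ R → ∀ y, ‖y - z‖ ≤ 2 * ‖k‖ →
      |dd k u y t - dd k u z t| ≤ K * (‖k‖ ^ 2 * ‖k‖ ^ α))
    (h' : ∀ k : EE n, σ0 ≤ ‖k‖ → ‖k‖ ≤ R → ∀ y, ‖y - z'‖ ≤ 2 * ‖k‖ →
      |dd k u y t - dd k u z' t| ≤ K * (‖k‖ ^ 2 * ‖k‖ ^ α))
    (k : EE n) (hk : σ0 ≤ ‖k‖) (j : ℕ)
    (hj : 2 ^ j * ‖k‖ ≤ R) (hzz : ‖z' - z‖ ≤ 2 * (2 ^ j * ‖k‖)) :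
    |dd k u z' t - dd k u z t|
      ≤ (1 + 1 / (2 ^ α - 1)) * K * (‖k‖ ^ 2 * (2 ^ j * ‖k‖) ^ α) := by
  have c1 := abs_le.mp (chain hα hK u t z h k hk j hj)
  have c2 := abs_le.mp (chain hα hK u t z' h' k hk j hj)
  set k' := (2 : ℝ) ^ j • k with hk'
  have hn : ‖k'‖ = 2 ^ j * ‖k‖ := by
    rw [hk', norm_smul, Real.norm_eq_abs, abs_of_pos (by positivity)]
  have hkk : σ0 ≤ ‖k'‖ := by
    rw [hn]
    have : (1 : ℝ) ≤ 2 ^ j := one_le_pow₀ (by norm_num)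
    nlinarith [norm_nonneg k]
  have c3 := abs_le.mp (h k' hkk (by rw [hn]; exact hj) z' (by rw [hn]; exact hzz))
  rw [hn] at c3
  set P := (2 ^ j * ‖k‖) ^ α with hP
  have e4 : ((2 : ℝ) ^ j * ‖k‖) ^ 2 = 4 ^ j * ‖k‖ ^ 2 := by
    rw [mul_pow, ← pow_mul, mul_comm j 2, pow_mul]; norm_num
  rw [e4] at c1 c2 c3
  have h4 : (0 : ℝ) < 4 ^ j := by positivity
  have h2α : 0 < (2 : ℝ) ^ α - 1 := by
    have := Real.one_lt_rpow (x := 2) (by norm_num) hα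
    linarith
  have e5 : (4 : ℝ) ^ j * ((1 + 1 / (2 ^ α - 1)) * K * (‖k‖ ^ 2 * P))
      = 2 * (1 / 2 / (2 ^ α - 1) * K * (4 ^ j * ‖k‖ ^ 2 * P)) + K * (4 ^ j * ‖k‖ ^ 2 * P) := by
    field_simp
    ring
  rw [abs_le]
  constructor
  · refine le_of_mul_le_mul_left ?_ h4
    linarith [c1.1, c1.2, c2.1, c2.2, c3.1, c3.2]
  · refine le_of_mul_le_mul_left ?_ h4
    linarith [c1.1, c1.2, c2.1, c2.2, c3.1, c3.2]

lemma small_two_pow {α ε : ℝ} (hα : α < 1) (hε : 0 < ε) :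
    ∃ m : ℕ, ((2 : ℝ) ^ m) ^ α / 2 ^ m ≤ ε := by
  have h1 : (2 : ℝ) ^ (α - 1) < 1 :=
    Real.rpow_lt_one_of_one_lt_of_neg (by norm_num) (by linarith)
  obtain ⟨m, hm⟩ := exists_pow_lt_of_lt_one hε h1
  refine ⟨m, le_of_eq_of_le ?_ hm.le⟩
  rw [Real.rpow_sub (by norm_num), Real.rpow_one, div_pow, ← Real.rpow_natCast, ← Real.rpow_natCast,
    ← Real.rpow_mul (by norm_num), ← Real.rpow_mul (by norm_num), mul_comm]

lemma Rough.d3_diff {n : ℕ} {α lam Λ ρ tb T S2 KF : ℝ} {a u u1 u2 ut}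
    (hR : Rough (n := n) α lam Λ ρ tb T S2 KF a u u1 u2 ut)
    {x k y : EE n} {t : ℝ} (hd : 0 < wd ρ tb x t) (htT : t ≤ T)
    (hk : ‖k‖ ≤ wd ρ tb x t / 16) (hy : ‖y - x‖ ≤ 2 * ‖k‖) :
    |dd k u y t - dd k u x t| ≤ 10 * S2 * ‖k‖ ^ 2 := by
  obtain ⟨g1, g2, g3, g4⟩ := wd_facts hd
  have hyn := norm_le_norm_add_norm_sub' y x
  have b1 := abs_le.mp (hR.dd_bound (y := y) (k := k) ⟨g2.le, htT⟩ (by linarith))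
  have b2 := abs_le.mp (hR.dd_bound (y := x) (k := k) ⟨g2.le, htT⟩ (by linarith))
  rw [abs_le]
  constructor <;> linarith [b1.1, b1.2, b2.1, b2.2]

set_option maxHeartbeats 1000000 in
lemma Rough.d3_step {n : ℕ} {α lam Λ : ℝ} (hα : α ∈ Ioo (0 : ℝ) 1) (hlam : 0 < lam) (hΛ : 0 < Λ)
    {ρ tb T S2 KF : ℝ} {a u u1 u2 ut} (hρ : ρ ≤ 2) (hS2 : 0 ≤ S2) (hKF : 0 ≤ KF)
    (hR : Rough (n := n) α lam Λ ρ tb T S2 KF a u u1 u2 ut) :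
    ∃ c : ℝ, 0 ≤ c ∧ ∀ δ : ℝ, 0 < δ → ∀ B : ℝ, 0 < B → D3 α ρ tb T u δ B →
      D3 α ρ tb T u δ (1 / 2 * B + c) := by
  obtain ⟨C3, hC3, td⟩ := Rough.td (n := n) hα hlam hΛ
  have h2α : 0 < (2 : ℝ) ^ α - 1 := by
    have := Real.one_lt_rpow (x := 2) (by norm_num) hα.1
    linarith
  set q := 1 + 1 / ((2 : ℝ) ^ α - 1) with hq
  have hq0 : 0 < q := by positivity
  obtain ⟨m, hm⟩ := small_two_pow (α := α) (ε := 1 / (32 * (C3 * q))) hα.2 (by positivity)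
  set N : ℝ := 2 ^ m with hN
  have hN1 : 1 ≤ N := one_le_pow₀ (by norm_num)
  have hN0 : 0 < N := by linarith
  set κ := 1 / (128 * N) with hκ
  have hκ0 : 0 < κ := by positivity
  set c1 := 80 * S2 / κ ^ α with hc1
  set c2 := C3 * (KF + S2) * (N ^ α * N) * 8 with hc2
  have hc10 : 0 ≤ c1 := by positivity
  have hc20 : 0 ≤ c2 := by positivity
  refine ⟨c1 + c2, by positivity, ?_⟩
  intro δ hδ B hB hD x t k y hd htT hδk hkd hyx
  have hdiff := hR.d3_diff hd htT hkd hyx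
  obtain ⟨g1, g2, g3, g4⟩ := wd_facts hd
  set d := wd ρ tb x t with hddef
  have hd2 : d ≤ 2 := by linarith [norm_nonneg x]
  set σ := ‖k‖ with hσ
  have hσ0 : 0 < σ := by linarith
  have hσα : 0 < σ ^ α := by positivity
  have hd3 : 0 < d ^ 3 := by positivity
  have hd8 : d ^ 3 ≤ 8 := by
    calc d ^ 3 ≤ 2 ^ 3 := by gcongr
      _ = 8 := by norm_num
  rcases le_total (κ * d) σ with hcase | hcase
  · -- large scales
    have hdd : d ≤ 2 * d ^ α := by
      have h2 : (d / 2) ≤ (d / 2) ^ α := by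
        have := Real.rpow_le_rpow_of_exponent_ge (x := d / 2) (by positivity) (by linarith) hα.2.le
        rwa [Real.rpow_one] at this
      have h3 : (d / 2) ^ α ≤ d ^ α := Real.rpow_le_rpow (by positivity) (by linarith) hα.1.le
      linarith
    have h1 : κ ^ α * d ^ α ≤ σ ^ α := by
      rw [← Real.mul_rpow hκ0.le hd.le]
      exact Real.rpow_le_rpow (by positivity) hcase hα.1.le
    have hκα : 0 < κ ^ α := by positivity
    have h2 : d ^ α ≤ σ ^ α / κ ^ α := by rw [le_div_iff₀ hκα]; linarith
    have h3 : d ^ 3 ≤ 8 * (σ ^ α / κ ^ α) := by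
      have : d ^ 3 ≤ 4 * d := by nlinarith
      linarith
    calc d ^ 3 * |dd k u y t - dd k u x t| ≤ (8 * (σ ^ α / κ ^ α)) * (10 * S2 * σ ^ 2) :=
          mul_le_mul h3 hdiff (abs_nonneg _) (by positivity)
      _ = c1 * (σ ^ 2 * σ ^ α) := by rw [hc1]; field_simp; ring
      _ ≤ (1 / 2 * B + (c1 + c2)) * (σ ^ 2 * σ ^ α) := by
          refine mul_le_mul_of_nonneg_right ?_ (by positivity)
          linarith
  · -- small scales
    set r := N * σ with hr
    have hr0 : 0 < r := by positivity
    have hrd : r ≤ d / 128 := by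
      have : N * σ ≤ N * (κ * d) := by gcongr
      refine this.trans (le_of_eq ?_)
      rw [hκ]; field_simp
    have hσr : σ ≤ r := by rw [hr]; nlinarith
    set K := 8 * B / d ^ 3 with hK
    have hK0 : 0 < K := by positivity
    have hosc : ∀ s ∈ Icc (t - r ^ 2) t, ∀ z, ‖z - x‖ ≤ 3 * r → ∀ z', ‖z' - x‖ ≤ 3 * r →
        ‖z' - z‖ ≤ 4 * r → |dd k u z' s - dd k u z s| ≤ q * K * (σ ^ 2 * (2 * r) ^ α) := by
      intro s hs z hz z' hz' hzz
      have hts : t - (d / 16) ^ 2 ≤ s := by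
        have : r ^ 2 ≤ (d / 16) ^ 2 := by gcongr; linarith
        linarith [hs.1]
      have w1 : d / 2 ≤ wd ρ tb z s := wd_half hd (by rw [← hddef]; linarith) hts
      have w2 : d / 2 ≤ wd ρ tb z' s := wd_half hd (by rw [← hddef]; linarith) hts
      have e1 : (2 : ℝ) ^ (m + 1) * σ = 2 * r := by rw [hr, hN, pow_succ]; ring
      have := osc_chain (R := d / 32) hα.1 hK0.le u s z z' (σ0 := δ)
        (fun k' h1 h2 y' h3 => hD.loc hd w1 (hs.2.trans htT) h1 h2 h3)
        (fun k' h1 h2 y' h3 => hD.loc hd w2 (hs.2.trans htT) h1 h2 h3) k hδk (m + 1)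
        (by rw [← hσ, e1]; linarith) (by rw [← hσ, e1]; linarith)
      rwa [← hσ, e1] at this
    set W := q * K * (σ ^ 2 * (2 * r ^ α)) with hW
    have hW0 : 0 < W := by positivity
    have hWle : q * K * (σ ^ 2 * (2 * r) ^ α) ≤ W := by
      rw [hW]
      have := rpow_mul_le (x := r) (c := 2) hr0.le (by norm_num) hα
      gcongr
    have hball : ∀ x' y' : EE n, x' - x = 0 ∧ y' = y ∨ y' - x = 0 ∧ x' = y →
        ∀ z ∈ closedBall ((1 / 2 : ℝ) • (x' + y')) (2 * r), ‖z - x‖ ≤ 3 * r := by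
      intro x' y' hxy z hz
      rw [mem_closedBall, dist_eq_norm] at hz
      have e : z - x = (z - (1 / 2 : ℝ) • (x' + y')) + (1 / 2 : ℝ) • (y - x) := by
        rcases hxy with ⟨h1, h2⟩ | ⟨h1, h2⟩
        · rw [sub_eq_zero] at h1
          subst h1 h2
          module
        · rw [sub_eq_zero] at h1
          subst h1 h2
          module
      rw [e]
      refine (norm_add_le _ _).trans ?_
      rw [norm_smul, Real.norm_eq_abs, abs_of_pos (by norm_num : (0 : ℝ) < 1 / 2)]
      linarith
    have hball2 : ∀ (p z z' : EE n), z ∈ closedBall p (2 * r) → z' ∈ closedBall p (2 * r) →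
        ‖z' - z‖ ≤ 4 * r := by
      intro p z z' hz hz'
      rw [mem_closedBall] at hz hz'
      rw [← dist_eq_norm]
      linarith [dist_triangle_right z' z p]
    have htb : tb ≤ t - r ^ 2 := by
      have : r ^ 2 ≤ d ^ 2 := by gcongr; linarith
      linarith
    have hyn := norm_le_norm_add_norm_sub' y x
    have t1 := td ρ tb T S2 KF a u u1 u2 ut hR hS2 hKF t r W k x y hσ0 hσr hW0
      (by rw [norm_sub_rev]; exact hyx) (by linarith) htb htT
      (fun s hs z hz z' hz' => (le_abs_self _).trans ((hosc s hs z'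
        (hball x y (Or.inl ⟨sub_self x, rfl⟩) z' hz') z (hball x y (Or.inl ⟨sub_self x, rfl⟩) z hz)
        (hball2 _ _ _ hz' hz)).trans hWle))
    have t2 := td ρ tb T S2 KF a u u1 u2 ut hR hS2 hKF t r W k y x hσ0 hσr hW0
      hyx (by linarith) htb htT
      (fun s hs z hz z' hz' => (le_abs_self _).trans ((hosc s hs z'
        (hball y x (Or.inr ⟨sub_self x, rfl⟩) z' hz') z (hball y x (Or.inr ⟨sub_self x, rfl⟩) z hz)
        (hball2 _ _ _ hz' hz)).trans hWle))
    rw [← hσ] at t1 t2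
    have t3 : |dd k u y t - dd k u x t| ≤ C3 * (W * σ / r + (KF + S2) * r ^ α * r * σ) := by
      rw [abs_le]
      constructor <;> linarith
    have t4 := mul_le_mul_of_nonneg_left t3 hd3.le
    refine t4.trans ?_
    have hrα : r ^ α = N ^ α * σ ^ α := by rw [hr, Real.mul_rpow hN0.le hσ0.le]
    have e2 : d ^ 3 * (C3 * (W * σ / r + (KF + S2) * r ^ α * r * σ))
        = (16 * (C3 * q) * (N ^ α / N) * B
          + d ^ 3 * (C3 * (KF + S2) * (N ^ α * N))) * (σ ^ 2 * σ ^ α) := by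
      rw [hW, hrα, hK, hr]
      field_simp
      ring
    rw [e2]
    refine mul_le_mul_of_nonneg_right ?_ (by positivity)
    have k1 : 16 * (C3 * q) * (N ^ α / N) * B ≤ 16 * (C3 * q) * (1 / (32 * (C3 * q))) * B := by
      gcongr
    have k2 : 16 * (C3 * q) * (1 / (32 * (C3 * q))) * B = 1 / 2 * B := by
      field_simp; ring
    have k3 : d ^ 3 * (C3 * (KF + S2) * (N ^ α * N)) ≤ 8 * (C3 * (KF + S2) * (N ^ α * N)) := by
      gcongr
    rw [hc2]
    linarith

lemma Rough.d3_all {n : ℕ} {α lam Λ : ℝ} (hα : α ∈ Ioo (0 : ℝ) 1) (hlam : 0 < lam) (hΛ : 0 < Λ)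
    {ρ tb T S2 KF : ℝ} {a u u1 u2 ut} (hρ : ρ ≤ 2) (hS2 : 0 ≤ S2) (hKF : 0 ≤ KF)
    (hR : Rough (n := n) α lam Λ ρ tb T S2 KF a u u1 u2 ut) :
    ∃ B : ℝ, 0 ≤ B ∧ ∀ δ : ℝ, 0 < δ → D3 α ρ tb T u δ B := by
  obtain ⟨c, hc, step⟩ := Rough.d3_step hα hlam hΛ hρ hS2 hKF hR
  refine ⟨c / (1 - 1 / 2), by norm_num; positivity, ?_⟩
  intro δ hδ
  have key := contraction_const
    (ι := {p : EE n × ℝ × EE n × EE n // 0 < wd ρ tb p.1 p.2.1 ∧ p.2.1 ≤ T ∧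
      δ ≤ ‖p.2.2.1‖ ∧ ‖p.2.2.1‖ ≤ wd ρ tb p.1 p.2.1 / 16 ∧ ‖p.2.2.2 - p.1‖ ≤ 2 * ‖p.2.2.1‖})
    (fun p => wd ρ tb p.1.1 p.1.2.1 ^ 3 *
      |dd p.1.2.2.1 u p.1.2.2.2 p.1.2.1 - dd p.1.2.2.1 u p.1.1 p.1.2.1|)
    (fun p => ‖p.1.2.2.1‖ ^ 2 * ‖p.1.2.2.1‖ ^ α) (1 / 2) c (by norm_num) (by norm_num)
    hc ?_ ⟨80 * S2 / δ ^ α + 1, by positivity, ?_⟩ ?_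
  · intro x t k y h1 h2 h3 h4 h5
    exact key ⟨(x, t, k, y), h1, h2, h3, h4, h5⟩
  · intro B hB hall ⟨⟨x, t, k, y⟩, h1, h2, h3, h4, h5⟩
    exact step δ hδ B hB
      (fun x t k y h1 h2 h3 h4 h5 => hall ⟨(x, t, k, y), h1, h2, h3, h4, h5⟩) x t k y h1 h2 h3 h4 h5
  · intro ⟨⟨x, t, k, y⟩, h1, h2, h3, h4, h5⟩
    simp only at h1 h2 h3 h4 h5 ⊢
    have hdiff := hR.d3_diff h1 h2 h4 h5
    obtain ⟨g1, g2, g3, g4⟩ := wd_facts h1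
    have hd8 : wd ρ tb x t ^ 3 ≤ 8 := by
      calc wd ρ tb x t ^ 3 ≤ 2 ^ 3 := by gcongr; linarith [norm_nonneg x]
        _ = 8 := by norm_num
    have hδα : 0 < δ ^ α := by positivity
    have h6 : δ ^ α ≤ ‖k‖ ^ α := Real.rpow_le_rpow hδ.le h3 hα.1.le
    have h7 : 1 ≤ ‖k‖ ^ α / δ ^ α := by rwa [one_le_div₀ hδα]
    calc wd ρ tb x t ^ 3 * |dd k u y t - dd k u x t| ≤ 8 * (10 * S2 * ‖k‖ ^ 2) :=
          mul_le_mul hd8 hdiff (abs_nonneg _) (by norm_num)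
      _ = 80 * S2 * ‖k‖ ^ 2 * 1 := by ring
      _ ≤ 80 * S2 * ‖k‖ ^ 2 * (‖k‖ ^ α / δ ^ α) := by gcongr
      _ = 80 * S2 / δ ^ α * (‖k‖ ^ 2 * ‖k‖ ^ α) := by field_simp
      _ ≤ _ := by
        refine mul_le_mul_of_nonneg_right ?_ (by positivity)
        linarith
  · intro p
    positivity



lemma quad_smul {n : ℕ} (B : EE n →L[ℝ] EE n →L[ℝ] ℝ) (c : ℝ) (v : EE n) :
    B (c • v) (c • v) = c ^ 2 * B v v := by
  rw [map_smul, map_smul, _root_.smul_apply, smul_eq_mul, smul_eq_mul]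
  ring

lemma cont_norm {E F : Type*} [NormedAddCommGroup E] [NormedAddCommGroup F] (g : E → F) (z : E)
    (hc : ContinuousAt g z) {ε : ℝ} (hε : 0 < ε) :
    ∃ δ : ℝ, 0 < δ ∧ ∀ y, ‖y - z‖ < δ → ‖g y - g z‖ < ε := by
  obtain ⟨δ, hδ, h⟩ := Metric.continuousAt_iff.mp hc ε hε
  refine ⟨δ, hδ, fun y hy => ?_⟩
  rw [← dist_eq_norm] at hy ⊢
  exact h hy

lemma Rough.dd_limit {n : ℕ} {α lam Λ ρ tb T S2 KF : ℝ} {a u u1 u2 ut}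
    (hR : Rough (n := n) α lam Λ ρ tb T S2 KF a u u1 u2 ut) (hα : 0 < α) {K R t : ℝ} (hK : 0 ≤ K)
    {z k : EE n} (ht : t ∈ Icc tb T) (hz : ‖z‖ + R < ρ) (hk0 : 0 < ‖k‖) (hkR : ‖k‖ ≤ R)
    (h : ∀ k : EE n, 0 < ‖k‖ → ‖k‖ ≤ R → ∀ y, ‖y - z‖ ≤ 2 * ‖k‖ →
      |dd k u y t - dd k u z t| ≤ K * (‖k‖ ^ 2 * ‖k‖ ^ α)) :
    |dd k u z t - u2 z t k k| ≤ 1 / 2 / (2 ^ α - 1) * K * (‖k‖ ^ 2 * ‖k‖ ^ α) := by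
  have hzb : z ∈ ball (0 : EE n) ρ := by rw [mem_ball_zero_iff]; linarith
  refine le_of_forall_pos_le_add ?_
  intro ε' hε'
  set ε := ε' / (2 * ‖k‖ ^ 2) with hε
  have hε0 : 0 < ε := by positivity
  have hc := (hR.cont2 t ht).continuousAt (isOpen_ball.mem_nhds hzb)
  obtain ⟨δ, hδ, hcd⟩ := cont_norm (E := EE n) (F := EE n →L[ℝ] EE n →L[ℝ] ℝ)
    (fun y => u2 y t) z hc hε0
  obtain ⟨j, hj⟩ := exists_pow_lt_of_lt_one (y := (1 / 2 : ℝ)) (x := δ / ‖k‖) (by positivity)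
    (by norm_num)
  set k' : EE n := ((1 / 2 : ℝ) ^ j) • k with hk'
  have hn : ‖k'‖ = (1 / 2) ^ j * ‖k‖ := by
    rw [hk', norm_smul, Real.norm_eq_abs, abs_of_pos (by positivity)]
  have hkδ : ‖k'‖ < δ := by
    rw [hn]; rwa [lt_div_iff₀ hk0] at hj
  have hk'0 : 0 < ‖k'‖ := by rw [hn]; positivity
  have h22 : (2 : ℝ) ^ j * (1 / 2) ^ j = 1 := by rw [← mul_pow]; norm_num
  have hnk : 2 ^ j * ‖k'‖ = ‖k‖ := by rw [hn, ← mul_assoc, h22, one_mul]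
  have hkk : (2 : ℝ) ^ j • k' = k := by rw [hk', smul_smul, h22, one_smul]
  have hk'k : ‖k'‖ ≤ ‖k‖ := by
    rw [← hnk]
    have : (1 : ℝ) ≤ 2 ^ j := one_le_pow₀ (by norm_num)
    nlinarith
  have c1 := chain hα hK u t z (σ0 := ‖k'‖) (R := R)
    (fun k1 h1 h2 y h3 => h k1 (hk'0.trans_le h1) h2 y h3) k' le_rfl j (by rw [hnk]; exact hkR)
  rw [hkk, hnk] at c1
  have hσk : ∀ σ ∈ Icc (-1 : ℝ) 1, ‖σ • k'‖ ≤ ‖k'‖ := by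
    intro σ hσ
    rw [norm_smul, Real.norm_eq_abs]
    have := abs_le.mpr hσ
    nlinarith
  have c2 := dd_taylor hR.reg (y := z) (k := k') (κ := ε) ht (fun σ hσ => by
      have h1 := hσk σ hσ
      rw [mem_ball_zero_iff]
      linarith [norm_add_le z (σ • k')]) (fun σ hσ => by
      have h1 := hσk σ hσ
      have := hcd (z + σ • k') (by rw [add_sub_cancel_left]; linarith)
      exact this.le)
  have e1 : u2 z t k k = 4 ^ j * u2 z t k' k' := by
    have e4 : (4 : ℝ) ^ j = (2 ^ j) ^ 2 := by rw [← pow_mul, mul_comm, pow_mul]; norm_num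
    rw [e4, ← quad_smul, hkk]
  have e2 : (4 : ℝ) ^ j * (2 * ε * ‖k'‖ ^ 2) = ε' := by
    have e4 : (4 : ℝ) ^ j = (2 ^ j) ^ 2 := by rw [← pow_mul, mul_comm, pow_mul]; norm_num
    have : (4 : ℝ) ^ j * (2 * ε * ‖k'‖ ^ 2) = 2 * ε * (2 ^ j * ‖k'‖) ^ 2 := by rw [e4]; ring
    rw [this, hnk, hε]
    field_simp
  have h4 : (0 : ℝ) < 4 ^ j := by positivity
  have c3 := abs_le.mp c2
  have c4 := mul_le_mul_of_nonneg_left c3.1 h4.le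
  have c5 := mul_le_mul_of_nonneg_left c3.2 h4.le
  have c6 := abs_le.mp c1
  rw [e1, abs_le]
  constructor
  · linarith [c6.1, c6.2]
  · linarith [c6.1, c6.2]

lemma Rough.ph {n : ℕ} {α lam Λ : ℝ} (hα : α ∈ Ioo (0 : ℝ) 1) (hlam : 0 < lam) (hΛ : 0 < Λ)
    {ρ tb T S2 KF : ℝ} {a u u1 u2 ut} (hρ : ρ ≤ 2) (hS2 : 0 ≤ S2) (hKF : 0 ≤ KF)
    (hR : Rough (n := n) α lam Λ ρ tb T S2 KF a u u1 u2 ut) :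
    ∃ H : ℝ, 0 < H ∧ PH α ρ tb T u2 H := by
  obtain ⟨B, hB, hD⟩ := Rough.d3_all hα hlam hΛ hρ hS2 hKF hR
  have h2α : 0 < (2 : ℝ) ^ α - 1 := by
    have := Real.one_lt_rpow (x := 2) (by norm_num) hα.1
    linarith
  set q := 1 + 1 / ((2 : ℝ) ^ α - 1) with hq
  have hq0 : 0 < q := by positivity
  refine ⟨q * (8 * B) + 256 * S2 + 1, by positivity, ?_⟩
  intro x t y hd htT hyx
  obtain ⟨g1, g2, g3, g4⟩ := wd_facts hd
  have hwy := wd_half hd hyx (s := t) (by nlinarith)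
  set d := wd ρ tb x t with hddef
  have hd2 : d ≤ 2 := by linarith [norm_nonneg x]
  have hd3 : 0 < d ^ 3 := by positivity
  have ht : t ∈ Icc tb T := ⟨g2.le, htT⟩
  have hyn := norm_le_norm_add_norm_sub' y x
  have hyb : y ∈ ball (0 : EE n) ρ := by rw [mem_ball_zero_iff]; linarith
  set τ := ‖y - x‖ with hτ
  have hτα : 0 ≤ τ ^ α := by positivity
  rcases eq_or_lt_of_le (norm_nonneg (y - x)) with h0 | hpos
  · have : y = x := by rw [← sub_eq_zero]; exact norm_eq_zero.mp h0.symm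
    have hz : ‖u2 y t - u2 x t‖ = 0 := by
      have hz0 : u2 y t = u2 x t := by rw [this]
      exact norm_eq_zero.mpr (sub_eq_zero.mpr hz0)
    rw [hz, mul_zero]
    positivity
  rw [← hτ] at hpos
  rcases le_total τ (d / 32) with hcase | hcase
  · set K := 8 * B / d ^ 3 with hK
    have hK0 : 0 ≤ K := by positivity
    have hm : ‖u2 y t - u2 x t‖ ≤ q * K * τ ^ α := by
      refine norm_le_of_quad (u2 y t - u2 x t) (fun v w => ?_) _ (by positivity) ?_
      · rw [_root_.sub_apply, _root_.sub_apply, _root_.sub_apply, _root_.sub_apply,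
          hR.reg.symm isOpen_ball hyb ht v w, hR.reg.symm isOpen_ball g1 ht v w]
      · intro e he
        have hn : ‖τ • e‖ = τ := by rw [norm_smul, he, mul_one, Real.norm_eq_abs, abs_of_pos hpos]
        have hx := fun k1 (h1 : 0 < ‖k1‖) (h2 : ‖k1‖ ≤ d / 32) y1 (h3 : ‖y1 - x‖ ≤ 2 * ‖k1‖) =>
          (hD _ h1).loc (z := x) (s := t) hd (by rw [← hddef]; linarith) htT le_rfl h2 h3
        have hy := fun k1 (h1 : 0 < ‖k1‖) (h2 : ‖k1‖ ≤ d / 32) y1 (h3 : ‖y1 - y‖ ≤ 2 * ‖k1‖) =>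
          (hD _ h1).loc (z := y) (s := t) hd hwy htT le_rfl h2 h3
        have l1 := hR.dd_limit hα.1 hK0 (z := x) (k := τ • e) (R := d / 32) ht (by linarith)
          (by rw [hn]; exact hpos) (by rw [hn]; exact hcase) hx
        have l2 := hR.dd_limit hα.1 hK0 (z := y) (k := τ • e) (R := d / 32) ht (by linarith)
          (by rw [hn]; exact hpos) (by rw [hn]; exact hcase) hy
        have l3 := hx (τ • e) (by rw [hn]; exact hpos) (by rw [hn]; exact hcase) y
          (by rw [hn]; linarith)
        have ex : ∀ z, u2 z t (τ • e) (τ • e) = τ ^ 2 * u2 z t e e := by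
          intro z
          rw [map_smul, map_smul, _root_.smul_apply, smul_eq_mul, smul_eq_mul]
          ring
        rw [hn, ex] at l1 l2
        rw [hn] at l3
        have hτ2 : 0 < τ ^ 2 := by positivity
        rw [_root_.sub_apply, _root_.sub_apply]
        have l1 := abs_le.mp l1
        have l2 := abs_le.mp l2
        have l3 := abs_le.mp l3
        have e5 : τ ^ 2 * (q * K * τ ^ α) = 2 * (1 / 2 / (2 ^ α - 1) * K * (τ ^ 2 * τ ^ α))
            + K * (τ ^ 2 * τ ^ α) := by
          rw [hq]; field_simp; ring
        rw [abs_le]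
        constructor
        · refine le_of_mul_le_mul_left ?_ hτ2
          linarith [l1.1, l1.2, l2.1, l2.2, l3.1, l3.2]
        · refine le_of_mul_le_mul_left ?_ hτ2
          linarith [l1.1, l1.2, l2.1, l2.2, l3.1, l3.2]
    calc d ^ 3 * ‖u2 y t - u2 x t‖ ≤ d ^ 3 * (q * K * τ ^ α) :=
          mul_le_mul_of_nonneg_left hm hd3.le
      _ = q * (8 * B) * τ ^ α := by rw [hK]; field_simp
      _ ≤ _ := by
        refine mul_le_mul_of_nonneg_right ?_ hτα
        linarith
  · have h1 : ‖u2 y t - u2 x t‖ ≤ 2 * S2 := by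
      have a1 := hR.hS t ht y hyb
      have a2 := hR.hS t ht x g1
      have a3 := norm_sub_le (u2 y t) (u2 x t)
      linarith
    have h2 : τ ≤ τ ^ α := by
      have := Real.rpow_le_rpow_of_exponent_ge (x := τ) hpos (by linarith) hα.2.le
      rwa [Real.rpow_one] at this
    have h3 : d ^ 3 ≤ 128 * τ ^ α := by
      have : d ^ 3 ≤ 4 * d := by nlinarith
      linarith
    calc d ^ 3 * ‖u2 y t - u2 x t‖ ≤ (128 * τ ^ α) * (2 * S2) :=
          mul_le_mul h3 h1 (norm_nonneg (u2 y t - u2 x t)) (by positivity)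
      _ = 256 * S2 * τ ^ α := by ring
      _ ≤ _ := by
        refine mul_le_mul_of_nonneg_right ?_ hτα
        have : 0 ≤ q * (8 * B) := by positivity
        linarith



lemma holder_double {n : ℕ} {α K r : ℝ} (hα : α ∈ Ioo (0 : ℝ) 1) (hK : 0 ≤ K) {s : Set (EE n)}
    (hs : Convex ℝ s) (F : EE n → ℝ)
    (h : ∀ y ∈ s, ∀ y' ∈ s, ‖y - y'‖ ≤ r → |F y - F y'| ≤ K * ‖y - y'‖ ^ α) :
    ∀ y ∈ s, ∀ y' ∈ s, ‖y - y'‖ ≤ 2 * r → |F y - F y'| ≤ 2 * K * ‖y - y'‖ ^ α := by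
  intro y hy y' hy' hr
  set p : EE n := (1 / 2 : ℝ) • y + (1 / 2 : ℝ) • y' with hp
  have hps : p ∈ s := hs hy hy' (by norm_num) (by norm_num) (by norm_num)
  have e1 : ‖y - p‖ = 1 / 2 * ‖y - y'‖ := by
    rw [show y - p = (1 / 2 : ℝ) • (y - y') by rw [hp]; module, norm_smul, Real.norm_eq_abs,
      abs_of_pos (by norm_num)]
  have e2 : ‖p - y'‖ = 1 / 2 * ‖y - y'‖ := by
    rw [show p - y' = (1 / 2 : ℝ) • (y - y') by rw [hp]; module, norm_smul, Real.norm_eq_abs,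
      abs_of_pos (by norm_num)]
  have h1 := h y hy p hps (by rw [e1]; linarith)
  have h2 := h p hps y' hy' (by rw [e2]; linarith)
  rw [e1] at h1
  rw [e2] at h2
  have h3 : (1 / 2 * ‖y - y'‖) ^ α ≤ ‖y - y'‖ ^ α :=
    Real.rpow_le_rpow (by positivity) (by linarith [norm_nonneg (y - y')]) hα.1.le
  have h4 := mul_le_mul_of_nonneg_left h3 hK
  have h1 := abs_le.mp h1
  have h2 := abs_le.mp h2
  rw [abs_le]
  constructor <;> linarith [h1.1, h1.2, h2.1, h2.2]

lemma Prob.toRough {n : ℕ} {α lam Λ ρ tb T M Kf S : ℝ} {a b c u u1 u2 ut}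
    (hP : Prob (n := n) α lam Λ ρ tb T M Kf a b c u u1 u2 ut) (hα : α ∈ Ioo (0 : ℝ) 1)
    (hΛ : 0 < Λ) (hρ : ρ ≤ 2) (hM : 0 ≤ M) (hKf : 0 ≤ Kf) (hS : 0 ≤ S)
    (cont2 : ∀ t ∈ Icc tb T, ContinuousOn (fun y => u2 y t) (ball 0 ρ))
    (hS1 : ∀ t ∈ Icc tb T, ∀ y ∈ ball (0 : EE n) ρ, ‖u1 y t‖ ≤ S)
    (hS2 : ∀ t ∈ Icc tb T, ∀ y ∈ ball (0 : EE n) ρ, ‖u2 y t‖ ≤ S) :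
    Rough α lam Λ ρ tb T S (2 * (2 * (Kf + Λ * M + 3 * Λ * S))) a u u1 u2 ut := by
  refine ⟨hP.reg, cont2, hP.ell, hP.bdd, hP.hol, hS2, ?_⟩
  intro t ht y hy y' hy'
  have h0 : ∀ y ∈ ball (0 : EE n) ρ, ∀ y' ∈ ball (0 : EE n) ρ, ‖y - y'‖ ≤ 1 → _ :=
    fun y hy y' hy' hyy => lower_order hα hΛ hP.reg ht (b := b) (c := c) (hP.bbdd t ht)
      (hP.bhol t ht) (hP.cbdd t ht) (hP.chol t ht) (hP.hu t ht) (hS1 t ht) (hS2 t ht) (hP.hf t ht)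
      hy hy' hyy
  have h1 := holder_double hα (by positivity) (convex_ball _ _)
    (fun y => ut y t - con (fun i j => a i j y t) (u2 y t)) h0
  have h2 := holder_double hα (by positivity) (convex_ball _ _)
    (fun y => ut y t - con (fun i j => a i j y t) (u2 y t)) h1
  refine h2 y hy y' hy' ?_
  rw [mem_ball_zero_iff] at hy hy'
  linarith [norm_sub_le y y']

lemma interior_est {n : ℕ} {α lam Λ : ℝ} (hα : α ∈ Ioo (0 : ℝ) 1) (hlam : 0 < lam) (hΛ : 0 < Λ) :
    ∃ C : ℝ, 0 < C ∧ ∀ (T M Kf S : ℝ) (a b c u u1 u2 ut), 0 ≤ M → 0 ≤ Kf → 0 ≤ S →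
      Prob (n := n) α lam Λ (7 / 4) (-2) T M Kf a b c u u1 u2 ut →
      (∀ t ∈ Icc (-2) T, ContinuousOn (fun y => u2 y t) (ball 0 (7 / 4))) →
      (∀ t ∈ Icc (-2) T, ∀ y ∈ ball (0 : EE n) (7 / 4), ‖u1 y t‖ ≤ S) →
      (∀ t ∈ Icc (-2) T, ∀ y ∈ ball (0 : EE n) (7 / 4), ‖u2 y t‖ ≤ S) →
      ∀ t ∈ Icc (-1) T, ∀ x ∈ ball (0 : EE n) 1, ‖u1 x t‖ ≤ C * (M + Kf) ∧
        ‖u2 x t‖ ≤ C * (M + Kf) ∧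
        ∀ y ∈ ball (0 : EE n) 1, ‖u2 x t - u2 y t‖ ≤ C * (M + Kf) * ‖x - y‖ ^ α := by
  obtain ⟨C0, hC0, hap⟩ := apriori (n := n) hα hlam hΛ
  refine ⟨11 * (171 + 8 * C0) + 3 * C0, by positivity, ?_⟩
  intro T M Kf S a b c u u1 u2 ut hM hKf hS hP cont2 hS1 hS2 t ht
  have hPH := hap (7 / 4) (-2) T M Kf a b c u u1 u2 ut (by norm_num) hM hKf hP
    (Rough.ph hα hlam hΛ (by norm_num) hS (by positivity)
      (hP.toRough hα hΛ (by norm_num) hM hKf hS cont2 hS1 hS2))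
  set Q := M + Kf with hQ
  have hQ0 : 0 ≤ Q := by positivity
  have hwd : ∀ x ∈ ball (0 : EE n) 1, 3 / 4 ≤ wd (7 / 4) (-2) x t := by
    intro x hx
    rw [mem_ball_zero_iff] at hx
    refine le_min (by linarith) ?_
    apply Real.le_sqrt_of_sq_le
    linarith [ht.1]
  have h316 : ((3 : ℝ) / 16) ^ α ≤ 1 := Real.rpow_le_one (by norm_num) (by norm_num) hα.1.le
  have h316' : (3 : ℝ) / 16 ≤ (3 / 16) ^ α := by
    have := Real.rpow_le_rpow_of_exponent_ge (x := 3 / 16) (by norm_num) (by norm_num) hα.2.le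
    rwa [Real.rpow_one] at this
  have hCQ : 0 ≤ C0 * Q := by positivity
  have hsup : ∀ x ∈ ball (0 : EE n) 1, ‖u2 x t‖ ≤ (171 + 8 * C0) * Q ∧
      ‖u1 x t‖ ≤ (171 + 8 * C0) * Q := by
    intro x hx
    have h1 := hP.sup hα hM hCQ hPH (d := 3 / 2) (η0 := 1 / 8) (y := x) (s := t) (by norm_num)
      (by norm_num) (by norm_num) (by norm_num) (by linarith [hwd x hx]) ht.2
    rw [show (1 : ℝ) / 8 * (3 / 2) = 3 / 16 by norm_num] at h1
    have h2 : 6 * M / (3 / 16) ^ 2 + 3 * (8 * (C0 * Q) / (3 / 2) ^ 3 * (3 / 16) ^ α)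
        ≤ (171 + 8 * C0) * Q := by
      have := mul_le_mul_of_nonneg_left h316 hCQ
      norm_num
      nlinarith
    exact ⟨h1.1.trans h2, h1.2.trans h2⟩
  have hle : (171 + 8 * C0) * Q ≤ (11 * (171 + 8 * C0) + 3 * C0) * Q := by
    refine mul_le_mul_of_nonneg_right ?_ hQ0
    linarith
  intro x hx
  refine ⟨(hsup x hx).2.trans hle, (hsup x hx).1.trans hle, ?_⟩
  intro y hy
  set r := ‖x - y‖ with hr
  have hr0 : 0 ≤ r := norm_nonneg _
  have hrα : 0 ≤ r ^ α := by positivity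
  have hSQ : 0 ≤ (171 + 8 * C0) * Q := by positivity
  rcases le_total r (3 / 16) with hc | hc
  · have h1 := hPH y t x (by linarith [hwd y hy]) ht.2 (by linarith [hwd y hy])
    rw [← hr] at h1
    have h2 : ((3 : ℝ) / 4) ^ 3 ≤ wd (7 / 4) (-2) y t ^ 3 := by
      have := hwd y hy
      gcongr
    have h3 := (mul_le_mul_of_nonneg_right h2 (norm_nonneg (u2 x t - u2 y t))).trans h1
    have h4 : 0 ≤ C0 * Q * r ^ α := by positivity
    have h5 : 0 ≤ (171 + 8 * C0) * Q * r ^ α := by positivity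
    have h6 : (11 * (171 + 8 * C0) + 3 * C0) * Q * r ^ α
      = 11 * ((171 + 8 * C0) * Q * r ^ α) + 3 * (C0 * Q * r ^ α) := by ring
    rw [h6]
    norm_num at h3
    linarith
  · have h1 := (hsup x hx).1
    have h2 := (hsup y hy).1
    have h3 := norm_sub_le (u2 x t) (u2 y t)
    have h4 : (3 : ℝ) / 16 ≤ r ^ α :=
      h316'.trans (Real.rpow_le_rpow (by norm_num) hc hα.1.le)
    have h5 := mul_le_mul_of_nonneg_left h4 hSQ
    have h4 : 0 ≤ C0 * Q * r ^ α := by positivity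
    have h6 : (11 * (171 + 8 * C0) + 3 * C0) * Q * r ^ α
      = 11 * ((171 + 8 * C0) * Q * r ^ α) + 3 * (C0 * Q * r ^ α) := by ring
    rw [h6]
    linarith

lemma HolderNormLE.out {n : ℕ} {α : ℝ} {g : EuclideanSpace ℝ (Fin n) → ℝ} {M : ℝ}
    (h : HolderNormLE n α g M) : 0 ≤ M ∧
    (∀ x ∈ ball (0 : EuclideanSpace ℝ (Fin n)) 2, |g x| ≤ M) ∧
    (∀ x ∈ ball (0 : EuclideanSpace ℝ (Fin n)) 2,
      ∀ y ∈ ball (0 : EuclideanSpace ℝ (Fin n)) 2, |g x - g y| ≤ M * ‖x - y‖ ^ α) := by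
  obtain ⟨S, H, hS, hH, hM, h1, h2⟩ := h
  refine ⟨by linarith, fun x hx => (h1 x hx).trans (by linarith), fun x hx y hy =>
    (h2 x hx y hy).trans (mul_le_mul_of_nonneg_right (by linarith) (by positivity))⟩

lemma norm_iter_two {n : ℕ} (g : EE n → ℝ) (x : EE n) :
    ‖iteratedFDeriv ℝ 2 g x‖ = ‖fderiv ℝ (fderiv ℝ g) x‖ := by
  have h1 := norm_iteratedFDeriv_fderiv (𝕜 := ℝ) (f := g) (n := 1) (x := x)
  have h2 := norm_iteratedFDeriv_one (𝕜 := ℝ) (fderiv ℝ g) (x := x)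
  rw [← h2, h1]

lemma norm_iter_two_sub {n : ℕ} (g : EE n → ℝ) (x y : EE n) :
    ‖iteratedFDeriv ℝ 2 g x - iteratedFDeriv ℝ 2 g y‖
      ≤ ‖fderiv ℝ (fderiv ℝ g) x - fderiv ℝ (fderiv ℝ g) y‖ := by
  refine ContinuousMultilinearMap.opNorm_le_bound
    (norm_nonneg (fderiv ℝ (fderiv ℝ g) x - fderiv ℝ (fderiv ℝ g) y)) fun m => ?_
  rw [_root_.sub_apply, iteratedFDeriv_two_apply, iteratedFDeriv_two_apply]
  have := (fderiv ℝ (fderiv ℝ g) x - fderiv ℝ (fderiv ℝ g) y).le_opNorm₂ (m 0) (m 1)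
  rw [Fin.prod_univ_two, ← mul_assoc]
  exact this

/-- **Brandt's non-standard interior Schauder estimate** (Theorem 3.4): for a classical
solution `u` of `∂u/∂t − a_{ij}D²_{ij}u − b_i D_i u − cu = f` on `B₂ × [−2,0]`, with
coefficients having spatial Hölder norms bounded uniformly in time by `Λ` and a uniform
ellipticity constant `λ`, one has for every `T ∈ (−1, 0]`
`sup_{t∈[−1,T]} ‖u(·,t)‖_{C^{2,α}(B₁)} ≤ C sup_{t∈[−2,T]} (‖u(·,t)‖_{C⁰(B₂)} + ‖f(·,t)‖_{C^{0,α}(B₂)})`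
with `C = C(n, λ, Λ, α)`. -/
theorem stmt_8 (n : ℕ) (hn : 1 ≤ n) (α : ℝ) (hα : α ∈ Set.Ioo (0 : ℝ) 1)
    (lam Λ : ℝ) (hlam : 0 < lam) (hΛ : 0 < Λ) :
    ∃ C : ℝ, 0 < C ∧
      ∀ (a : Fin n → Fin n → EuclideanSpace ℝ (Fin n) → ℝ → ℝ)
        (b : Fin n → EuclideanSpace ℝ (Fin n) → ℝ → ℝ)
        (c f u : EuclideanSpace ℝ (Fin n) → ℝ → ℝ),
        -- regularity of `u`: continuous with two spatial derivatives and one time derivative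
        (∀ t ∈ Icc (-2 : ℝ) 0,
          ContDiffOn ℝ 2 (fun x => u x t) (ball (0 : EuclideanSpace ℝ (Fin n)) 2)) →
        (∀ x ∈ ball (0 : EuclideanSpace ℝ (Fin n)) 2, ∀ t ∈ Icc (-2 : ℝ) 0,
          DifferentiableWithinAt ℝ (u x) (Icc (-2 : ℝ) 0) t) →
        ContinuousOn (fun p : EuclideanSpace ℝ (Fin n) × ℝ => u p.1 p.2)
          (ball (0 : EuclideanSpace ℝ (Fin n)) 2 ×ˢ Icc (-2 : ℝ) 0) →
        ContinuousOn (fun p : EuclideanSpace ℝ (Fin n) × ℝ =>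
            fderiv ℝ (fun y => u y p.2) p.1)
          (ball (0 : EuclideanSpace ℝ (Fin n)) 2 ×ˢ Icc (-2 : ℝ) 0) →
        ContinuousOn (fun p : EuclideanSpace ℝ (Fin n) × ℝ =>
            iteratedFDeriv ℝ 2 (fun y => u y p.2) p.1)
          (ball (0 : EuclideanSpace ℝ (Fin n)) 2 ×ˢ Icc (-2 : ℝ) 0) →
        ContinuousOn (fun p : EuclideanSpace ℝ (Fin n) × ℝ =>
            derivWithin (u p.1) (Icc (-2 : ℝ) 0) p.2)
          (ball (0 : EuclideanSpace ℝ (Fin n)) 2 ×ˢ Icc (-2 : ℝ) 0) →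
        -- the equation
        (∀ x ∈ ball (0 : EuclideanSpace ℝ (Fin n)) 2, ∀ t ∈ Icc (-2 : ℝ) 0,
          derivWithin (u x) (Icc (-2 : ℝ) 0) t
              - (∑ i : Fin n, ∑ j : Fin n, a i j x t *
                  iteratedFDeriv ℝ 2 (fun y => u y t) x
                    ![EuclideanSpace.single i (1 : ℝ), EuclideanSpace.single j (1 : ℝ)])
              - (∑ i : Fin n, b i x t *
                  fderiv ℝ (fun y => u y t) x (EuclideanSpace.single i (1 : ℝ)))
              - c x t * u x t
            = f x t) →
        -- the spatial Hölder norms of the coefficients are bounded uniformly in time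
        (∀ t ∈ Icc (-2 : ℝ) 0,
          ∃ (Ma : Fin n → Fin n → ℝ) (Mb : Fin n → ℝ) (Mc : ℝ),
            (∀ i j, HolderNormLE n α (fun x => a i j x t) (Ma i j)) ∧
            (∀ i, HolderNormLE n α (fun x => b i x t) (Mb i)) ∧
            HolderNormLE n α (fun x => c x t) Mc ∧
            (∑ i : Fin n, ∑ j : Fin n, Ma i j) + (∑ i : Fin n, Mb i) + Mc < Λ) →
        -- uniform parabolicity
        (∀ x ∈ ball (0 : EuclideanSpace ℝ (Fin n)) 2, ∀ t ∈ Icc (-2 : ℝ) 0,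
          ∀ ξ : Fin n → ℝ,
            lam * (∑ i : Fin n, ξ i ^ 2) ≤ ∑ i : Fin n, ∑ j : Fin n, a i j x t * ξ i * ξ j) →
        -- conclusion
        ∀ T ∈ Set.Ioc (-1 : ℝ) 0, ∀ Mrhs : ℝ,
          (∀ t ∈ Icc (-2 : ℝ) T, ∃ Mu Mf : ℝ, 0 ≤ Mu ∧
            (∀ x ∈ ball (0 : EuclideanSpace ℝ (Fin n)) 2, |u x t| ≤ Mu) ∧
            HolderNormLE n α (fun x => f x t) Mf ∧ Mu + Mf ≤ Mrhs) →
          ∀ t ∈ Icc (-1 : ℝ) T,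
            ∃ S Hs : ℝ, 0 ≤ S ∧ 0 ≤ Hs ∧
              (∀ x ∈ ball (0 : EuclideanSpace ℝ (Fin n)) 1,
                |u x t| + ‖fderiv ℝ (fun y => u y t) x‖
                    + ‖iteratedFDeriv ℝ 2 (fun y => u y t) x‖ ≤ S) ∧
              (∀ x ∈ ball (0 : EuclideanSpace ℝ (Fin n)) 1,
                ∀ y ∈ ball (0 : EuclideanSpace ℝ (Fin n)) 1,
                  ‖iteratedFDeriv ℝ 2 (fun z => u z t) x
                      - iteratedFDeriv ℝ 2 (fun z => u z t) y‖ ≤ Hs * ‖x - y‖ ^ α) ∧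
              S + Hs ≤ C * Mrhs := by
  obtain ⟨C1, hC1, est⟩ := interior_est (n := n) hα hlam hΛ
  refine ⟨1 + 6 * C1, by positivity, ?_⟩
  intro a b c f u hcd hdt hcu hcu1 hcu2 hcut heq hcoef hell T hT Mrhs hrhs
  have hTI : Icc (-2 : ℝ) T ⊆ Icc (-2 : ℝ) 0 := Icc_subset_Icc_right hT.2
  have hsub : ball (0 : EE n) (7 / 4) ⊆ ball (0 : EE n) 2 := ball_subset_ball (by norm_num)
  have hM0 : 0 ≤ Mrhs := by
    obtain ⟨Mu, Mf, h1, h2, h3, h4⟩ := hrhs (-2) ⟨le_rfl, by linarith [hT.1]⟩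
    linarith [h3.out.1]
  set u1 : EE n → ℝ → EE n →L[ℝ] ℝ := fun x t => fderiv ℝ (fun y => u y t) x with hu1
  set u2 : EE n → ℝ → EE n →L[ℝ] EE n →L[ℝ] ℝ :=
    fun x t => fderiv ℝ (fderiv ℝ (fun y => u y t)) x with hu2
  set ut : EE n → ℝ → ℝ := fun x t => derivWithin (u x) (Icc (-2 : ℝ) 0) t with hut
  -- regularity
  have hcd1 : ∀ t ∈ Icc (-2 : ℝ) 0, ContDiffOn ℝ 1 (fderiv ℝ (fun y => u y t)) (ball (0 : EE n) 2) :=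
    fun t ht => (hcd t ht).fderiv_of_isOpen isOpen_ball (by norm_num)
  have hreg0 : Reg (ball (0 : EE n) 2) (Icc (-2 : ℝ) 0) u u1 u2 ut := by
    refine ⟨fun x hx t ht => ?_, fun x hx t ht => ?_, fun x hx t ht => ?_, hcu⟩
    · exact (((hcd t ht).differentiableOn (by norm_num)).differentiableAt
        (isOpen_ball.mem_nhds hx)).hasFDerivAt
    · exact (((hcd1 t ht).differentiableOn (by norm_num)).differentiableAt
        (isOpen_ball.mem_nhds hx)).hasFDerivAt
    · exact (hdt x hx t ht).hasDerivWithinAt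
  have hreg : Reg (ball (0 : EE n) (7 / 4)) (Icc (-2 : ℝ) T) u u1 u2 ut := hreg0.mono hsub hTI
  have hcont2 : ∀ t ∈ Icc (-2) T, ContinuousOn (fun y => u2 y t) (ball (0 : EE n) (7 / 4)) :=
    fun t ht => ((hcd1 t (hTI ht)).continuousOn_fderiv_of_isOpen isOpen_ball le_rfl).mono hsub
  -- the equation
  have hLL : ∀ t ∈ Icc (-2 : ℝ) 0, ∀ x ∈ ball (0 : EE n) 2, LL a b c u u1 u2 ut x t = f x t := by
    intro t ht x hx
    rw [← heq x hx t ht]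
    simp only [LL, con, hu1, hu2, hut, iteratedFDeriv_two_apply]
    rfl
  -- structure constants
  have hcf : ∀ t ∈ Icc (-2 : ℝ) 0,
      ∃ (Ma : Fin n → Fin n → ℝ) (Mb : Fin n → ℝ) (Mc : ℝ),
            (∀ i j, HolderNormLE n α (fun x => a i j x t) (Ma i j)) ∧
            (∀ i, HolderNormLE n α (fun x => b i x t) (Mb i)) ∧
            HolderNormLE n α (fun x => c x t) Mc ∧
            (∑ i : Fin n, ∑ j : Fin n, Ma i j) ≤ Λ ∧ (∑ i : Fin n, Mb i) ≤ Λ ∧ Mc ≤ Λ := by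
    intro t ht
    obtain ⟨Ma, Mb, Mc, h1, h2, h3, h4⟩ := hcoef t ht
    have p1 : 0 ≤ ∑ i : Fin n, ∑ j : Fin n, Ma i j :=
      Finset.sum_nonneg fun i _ => Finset.sum_nonneg fun j _ => (h1 i j).out.1
    have p2 : 0 ≤ ∑ i : Fin n, Mb i := Finset.sum_nonneg fun i _ => (h2 i).out.1
    have p3 := h3.out.1
    exact ⟨Ma, Mb, Mc, h1, h2, h3, by linarith, by linarith, by linarith⟩
  have hP : Prob α lam Λ (7 / 4) (-2) T Mrhs Mrhs a b c u u1 u2 ut := by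
    refine ⟨hreg, fun t ht y hy ξ => hell y (hsub hy) t (hTI ht) ξ, ?_, ?_, ?_, ?_, ?_, ?_, ?_, ?_⟩
    · intro t ht y hy
      obtain ⟨Ma, Mb, Mc, h1, h2, h3, h4, h5, h6⟩ := hcf t (hTI ht)
      exact (Finset.sum_le_sum fun i _ => Finset.sum_le_sum fun j _ =>
        (h1 i j).out.2.1 y (hsub hy)).trans h4
    · intro t ht y hy y' hy'
      obtain ⟨Ma, Mb, Mc, h1, h2, h3, h4, h5, h6⟩ := hcf t (hTI ht)
      refine (Finset.sum_le_sum fun i _ => Finset.sum_le_sum fun j _ =>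
        (h1 i j).out.2.2 y (hsub hy) y' (hsub hy')).trans ?_
      simp only [← Finset.sum_mul]
      exact mul_le_mul_of_nonneg_right h4 (by positivity)
    · intro t ht y hy
      obtain ⟨Ma, Mb, Mc, h1, h2, h3, h4, h5, h6⟩ := hcf t (hTI ht)
      exact (Finset.sum_le_sum fun i _ => (h2 i).out.2.1 y (hsub hy)).trans h5
    · intro t ht y hy y' hy'
      obtain ⟨Ma, Mb, Mc, h1, h2, h3, h4, h5, h6⟩ := hcf t (hTI ht)
      refine (Finset.sum_le_sum fun i _ => (h2 i).out.2.2 y (hsub hy) y' (hsub hy')).trans ?_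
      simp only [← Finset.sum_mul]
      exact mul_le_mul_of_nonneg_right h5 (by positivity)
    · intro t ht y hy
      obtain ⟨Ma, Mb, Mc, h1, h2, h3, h4, h5, h6⟩ := hcf t (hTI ht)
      exact (h3.out.2.1 y (hsub hy)).trans h6
    · intro t ht y hy y' hy'
      obtain ⟨Ma, Mb, Mc, h1, h2, h3, h4, h5, h6⟩ := hcf t (hTI ht)
      exact (h3.out.2.2 y (hsub hy) y' (hsub hy')).trans
        (mul_le_mul_of_nonneg_right h6 (by positivity))
    · intro t ht y hy
      obtain ⟨Mu, Mf, h1, h2, h3, h4⟩ := hrhs t ht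
      exact (h2 y (hsub hy)).trans (by linarith [h3.out.1])
    · intro t ht y hy y' hy'
      obtain ⟨Mu, Mf, h1, h2, h3, h4⟩ := hrhs t ht
      rw [hLL t (hTI ht) y (hsub hy), hLL t (hTI ht) y' (hsub hy')]
      exact (h3.out.2.2 y (hsub hy) y' (hsub hy')).trans
        (mul_le_mul_of_nonneg_right (by linarith) (by positivity))
  -- qualitative bounds
  have hcpt : IsCompact (closedBall (0 : EE n) (7 / 4) ×ˢ Icc (-2 : ℝ) 0) :=
    (isCompact_closedBall _ _).prod isCompact_Icc
  have hcsub : closedBall (0 : EE n) (7 / 4) ×ˢ Icc (-2 : ℝ) 0 ⊆ ball (0 : EE n) 2 ×ˢ Icc (-2 : ℝ) 0 :=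
    prod_mono (closedBall_subset_ball (by norm_num)) le_rfl
  obtain ⟨S1, hS1⟩ := hcpt.exists_bound_of_continuousOn (hcu1.mono hcsub)
  obtain ⟨S2, hS2⟩ := hcpt.exists_bound_of_continuousOn (hcu2.mono hcsub)
  have hmain := est T Mrhs Mrhs (max (max S1 S2) 0) a b c u u1 u2 ut hM0 hM0 (le_max_right _ _) hP
    hcont2
    (fun t ht y hy => (hS1 (y, t) ⟨ball_subset_closedBall hy, hTI ht⟩).trans
      ((le_max_left _ _).trans (le_max_left _ _)))
    (fun t ht y hy => by
      have h1 := hS2 (y, t) ⟨ball_subset_closedBall hy, hTI ht⟩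
      have h2 := norm_iter_two (fun y => u y t) y
      have h3 : ‖u2 y t‖ ≤ S2 := by rw [hu2]; simp only; rw [← h2]; exact h1
      exact h3.trans ((le_max_right _ _).trans (le_max_left _ _)))
  intro t ht
  have ht2 : t ∈ Icc (-2 : ℝ) T := ⟨by linarith [ht.1], ht.2⟩
  refine ⟨Mrhs + 2 * (C1 * (Mrhs + Mrhs)), C1 * (Mrhs + Mrhs), by positivity, by positivity, ?_, ?_,
    le_of_eq (by ring)⟩
  · intro x hx
    obtain ⟨g1, g2, g3⟩ := hmain t ht x hx
    have g0 := hP.hu t ht2 x (ball_subset_ball (by norm_num) hx)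
    have h2 := norm_iter_two (fun y => u y t) x
    rw [h2]
    linarith
  · intro x hx y hy
    obtain ⟨g1, g2, g3⟩ := hmain t ht x hx
    exact (norm_iter_two_sub (fun z => u z t) x y).trans (g3 y hy)
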